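/- arXiv:1004.1292 — 4 statements merged into one kernel-verified Lean document; each statement's English description precedes it below -/
import Mathlib

section
/- For integers α ≥ 0, β ≥ 1, r with 1 ≤ r ≤ min(α, β-1)+1, and j ≥ 0, the probability that an A-served side-out game sequence yields α points for A, β points for B, exactly r A-interruptions and j exchanges, with B scoring the last point, equals C(α+β+j-1, j) · C(α, r-1) · C(β-1, r-1) · p_a^α · p_b^β · (1-p_a) · q^{r+j-1}, where q = (1-p_a)(1-p_b). -/
open scoped BigOperators
open Filter

/-- Side-out scoring: a trajectory is the list of rally outcomes, `true` meaning that the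
current server wins the rally.  `soScorers srv g` is the list of scorers (`true` = player A),
where `srv` is the current server. -/
def soScorers : Bool → List Bool → List Bool
  | _, [] => []
  | srv, s :: rest => (if s then [srv] else []) ++ soScorers (if s then srv else !srv) rest

/-- Probability weight of a trajectory of rally outcomes: the server wins a rally with
probability `pa` (if A serves) or `pb` (if B serves); rallies are independent. -/
def soWeight (pa pb : ℝ) : Bool → List Bool → ℝ
  | _, [] => 1
  | srv, s :: rest =>
      (if srv then (if s then pa else 1 - pa) else (if s then pb else 1 - pb)) *
        soWeight pa pb (if s then srv else !srv) rest

/-- Points scored by player A (first server A). -/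
def soScoreA (g : List Bool) : ℕ := (soScorers true g).count true

/-- Points scored by player B (first server A). -/
def soScoreB (g : List Bool) : ℕ := (soScorers true g).count false

/-- The trajectory ends with a rally in which A scores a point. -/
def soLastA (g : List Bool) : Prop :=
  g.getLast? = some true ∧ (soScorers true g).getLast? = some true

/-- The trajectory ends with a rally in which B scores a point. -/
def soLastB (g : List Bool) : Prop :=
  g.getLast? = some true ∧ (soScorers true g).getLast? = some false

/-- Number of maximal runs of `false` in a list, the first argument being the previous value. -/
def falseRuns : Bool → List Bool → ℕ
  | _, [] => 0
  | prev, b :: rest => (if prev && !b then 1 else 0) + falseRuns b rest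

/-- Number of A-interruptions: maximal stretches in which B gains the serve from A and
scores at least one point, i.e. maximal blocks of points scored by B. -/
def soInter (g : List Bool) : ℕ := falseRuns true (soScorers true g)

/-- Number of exchanges: pairs of consecutive rallies in which a player gains the right to
serve and immediately loses it without scoring. -/
def exchCount : List Bool → ℕ
  | [] => 0
  | true :: rest => exchCount rest
  | [false] => 0
  | false :: true :: rest => exchCount rest
  | false :: false :: rest => 1 + exchCount rest

/-- Probability of a set of trajectories in the side-out model, first server A. -/
noncomputable def soPr (pa pb : ℝ) (E : Set (List Bool)) : ℝ :=
  ∑' g : List Bool, Set.indicator E (soWeight pa pb true) g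

/-- Conditional expectation of `f` given the event `E` in the side-out model, first server A. -/
noncomputable def soCondExp (pa pb : ℝ) (E : Set (List Bool)) (f : List Bool → ℝ) : ℝ :=
  (∑' g : List Bool, Set.indicator E (fun g => soWeight pa pb true g * f g) g) / soPr pa pb E

/-- The number of compositions of `n` into `k` positive parts. -/
def compositionCount : ℕ → ℕ → ℕ
  | 0, 0 => 1
  | 0, _ + 1 => 0
  | _ + 1, 0 => 0
  | n + 1, k + 1 => n.choose k

/-- The number of scoring orders with `a` points for A and `b` points for B, following a point
of the given player, in which B scores in `r` new runs and B is the last scorer. -/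
def orderCount : Bool → ℕ → ℕ → ℕ → ℕ
  | true, _, _, 0 => 0
  | true, a, b, r + 1 => a.choose r * compositionCount b (r + 1)
  | false, a, b, r => b.choose r * compositionCount a r

/-- The continuation `g` of a game, following a point of the server `srv`, has the given
statistics and leaves B as the scorer of the last rally. -/
def IsContinuation (srv : Bool) (a b r j : ℕ) (g : List Bool) : Prop :=
  (soScorers srv g).count true = a ∧ (soScorers srv g).count false = b ∧
    ((true :: g).getLast? = some true ∧ (srv :: soScorers srv g).getLast? = some false) ∧
    falseRuns srv (soScorers srv g) = r ∧ exchCount g = j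

open Classical in
/-- The weight of a continuation with the given statistics, and zero for other trajectories. -/
noncomputable def continuationWeight (pa pb : ℝ) (srv : Bool) (a b r j : ℕ) (g : List Bool) : ℝ :=
  if IsContinuation srv a b r j g then soWeight pa pb srv g else 0

/-- The total weight of the continuations with the given statistics. -/
noncomputable def continuationProb (pa pb : ℝ) (srv : Bool) (a b r j : ℕ) : ℝ :=
  (orderCount srv a b r : ℝ) * ((a + b).multichoose j : ℝ) * pa ^ a * pb ^ b * (1 - pa) ^ r *
    (1 - pb) ^ (if srv then r - 1 else r) * ((1 - pa) * (1 - pb)) ^ j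

/-- The sequence `f` preceded by a zero. -/
def shiftZero (f : ℕ → ℝ) : ℕ → ℝ
  | 0 => 0
  | n + 1 => f n

theorem hasSum_list_bool {f : List Bool → ℝ} {x y : ℝ}
    (hx : HasSum (fun g => f (true :: g)) x) (hy : HasSum (fun g => f (false :: g)) y) :
    HasSum f (f [] + (x + y)) := by
  let e : Unit ⊕ (List Bool ⊕ List Bool) ≃ List Bool :=
    { toFun := Sum.elim (fun _ => []) (Sum.elim (true :: ·) (false :: ·))
      invFun := fun l => match l with
        | [] => Sum.inl ()
        | true :: g => Sum.inr (Sum.inl g)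
        | false :: g => Sum.inr (Sum.inr g)
      left_inv := by rintro (_ | _ | _) <;> rfl
      right_inv := by rintro (_ | ⟨_ | _, _⟩) <;> rfl }
  rw [← e.hasSum_iff]
  exact HasSum.sum (hasSum_unique fun _ : Unit => f []) (HasSum.sum hx hy)

theorem hasSum_list_bool_pairs {f : List Bool → ℝ} {x y z : ℝ} (hf : f [false] = 0)
    (hx : HasSum (fun g => f (true :: g)) x) (hy : HasSum (fun g => f (false :: true :: g)) y)
    (hz : HasSum (fun g => f (false :: false :: g)) z) :
    HasSum f (f [] + x + y + z) := by
  have h := hasSum_list_bool hx (hasSum_list_bool hy hz)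
  rw [hf] at h
  convert h using 1
  ring

theorem continuationWeight_nil (pa pb : ℝ) (srv : Bool) (a b r j : ℕ) :
    continuationWeight pa pb srv a b r j [] =
      if srv = false ∧ a = 0 ∧ b = 0 ∧ r = 0 ∧ j = 0 then 1 else 0 := by
  unfold continuationWeight
  congr 1
  simp [IsContinuation, soScorers, falseRuns, exchCount]
  grind

theorem continuationWeight_singleton_false (pa pb : ℝ) (srv : Bool) (a b r j : ℕ) :
    continuationWeight pa pb srv a b r j [false] = 0 := by
  simp [continuationWeight, IsContinuation]

theorem continuationWeight_eq_zero {pa pb : ℝ} {srv : Bool} {a b r j : ℕ} {g : List Bool}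
    (h : ¬ IsContinuation srv a b r j g) : continuationWeight pa pb srv a b r j g = 0 :=
  if_neg h

theorem continuationWeight_eq_mul {pa pb c : ℝ} {srv srv' : Bool} {a b r j a' b' r' j' : ℕ}
    {g g' : List Bool} (h : IsContinuation srv a b r j g ↔ IsContinuation srv' a' b' r' j' g')
    (hw : soWeight pa pb srv g = c * soWeight pa pb srv' g') :
    continuationWeight pa pb srv a b r j g = c * continuationWeight pa pb srv' a' b' r' j' g' := by
  by_cases hg : IsContinuation srv' a' b' r' j' g'
  · simp [continuationWeight, hg, h.2 hg, hw]
  · simp [continuationWeight, hg, mt h.1 hg]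

theorem continuationWeight_true_of_serverA (pa pb : ℝ) (a b r j : ℕ) (g : List Bool) :
    continuationWeight pa pb true a b r j (true :: g) =
      pa * shiftZero (fun a => continuationWeight pa pb true a b r j g) a := by
  cases a with
  | zero =>
    rw [continuationWeight_eq_zero (by simp [IsContinuation, soScorers])]
    simp [shiftZero]
  | succ a =>
    exact continuationWeight_eq_mul
      (by simp [IsContinuation, soScorers, falseRuns, exchCount]) (by simp [soWeight])

theorem continuationWeight_true_of_serverB (pa pb : ℝ) (a b r j : ℕ) (g : List Bool) :
    continuationWeight pa pb false a b r j (true :: g) =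
      pb * shiftZero (fun b => continuationWeight pa pb false a b r j g) b := by
  cases b with
  | zero =>
    rw [continuationWeight_eq_zero (by simp [IsContinuation, soScorers])]
    simp [shiftZero]
  | succ b =>
    exact continuationWeight_eq_mul
      (by simp [IsContinuation, soScorers, falseRuns, exchCount]) (by simp [soWeight])

theorem continuationWeight_false_true_of_serverA (pa pb : ℝ) (a b r j : ℕ) (g : List Bool) :
    continuationWeight pa pb true a b r j (false :: true :: g) =
      (1 - pa) * pb *
        shiftZero (fun r => shiftZero (fun b => continuationWeight pa pb false a b r j g) b) r := by
  cases r with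
  | zero =>
    rw [continuationWeight_eq_zero (by simp [IsContinuation, soScorers, falseRuns])]
    simp [shiftZero]
  | succ r =>
    cases b with
    | zero =>
      rw [continuationWeight_eq_zero (by simp [IsContinuation, soScorers])]
      simp [shiftZero]
    | succ b =>
      exact continuationWeight_eq_mul
        (by simp [IsContinuation, soScorers, falseRuns, exchCount, add_comm 1])
        (by simp [soWeight, mul_assoc])

theorem continuationWeight_false_true_of_serverB (pa pb : ℝ) (a b r j : ℕ) (g : List Bool) :
    continuationWeight pa pb false a b r j (false :: true :: g) =
      (1 - pb) * pa * shiftZero (fun a => continuationWeight pa pb true a b r j g) a := by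
  cases a with
  | zero =>
    rw [continuationWeight_eq_zero (by simp [IsContinuation, soScorers])]
    simp [shiftZero]
  | succ a =>
    exact continuationWeight_eq_mul
      (by simp [IsContinuation, soScorers, falseRuns, exchCount])
      (by simp [soWeight, mul_assoc])

theorem soScorers_ne_nil {srv : Bool} {g : List Bool} (h : g.getLast? = some true) :
    soScorers srv g ≠ [] := by
  induction g generalizing srv with
  | nil => simp at h
  | cons s g ih =>
    cases s with
    | true => simp [soScorers]
    | false =>
      rcases g with _ | ⟨t, g⟩
      · simp at h
      · simpa [soScorers] using ih (srv := !srv) (by simpa using h)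

theorem isContinuation_false_false_iff (srv : Bool) (a b r j : ℕ) (g : List Bool) :
    IsContinuation srv a b r j (false :: false :: g) ↔
      (a ≠ 0 ∨ b ≠ 0) ∧ ∃ i, j = i + 1 ∧ IsContinuation srv a b r i g := by
  have hab : (soScorers srv g).count true ≠ 0 ∨ (soScorers srv g).count false ≠ 0 ↔
      soScorers srv g ≠ [] := by
    rcases soScorers srv g with _ | ⟨_ | _, l⟩ <;> simp
  have hlast : (true :: false :: false :: g).getLast? = some true ↔
      soScorers srv g ≠ [] ∧ (true :: g).getLast? = some true := by
    rcases g with _ | ⟨s, g⟩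
    · simp [soScorers]
    · simp only [List.getLast?_cons_cons]
      exact ⟨fun h => ⟨soScorers_ne_nil h, h⟩, And.right⟩
  simp only [IsContinuation, soScorers, exchCount, hlast, ← hab]
  simp only [Bool.false_eq_true, if_false, List.nil_append, Bool.not_not]
  grind

theorem continuationWeight_false_false (pa pb : ℝ) (srv : Bool) (a b r j : ℕ) (g : List Bool) :
    continuationWeight pa pb srv a b r j (false :: false :: g) =
      (if a = 0 ∧ b = 0 then 0 else (1 - pa) * (1 - pb)) *
        shiftZero (fun j => continuationWeight pa pb srv a b r j g) j := by
  have hw : soWeight pa pb srv (false :: false :: g) =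
      (1 - pa) * (1 - pb) * soWeight pa pb srv g := by
    cases srv <;> simp [soWeight] <;> ring
  by_cases hab : a = 0 ∧ b = 0
  · rw [continuationWeight_eq_zero (by simp [isContinuation_false_false_iff, hab])]
    simp [hab]
  · rw [if_neg hab]
    cases j with
    | zero =>
      rw [continuationWeight_eq_zero (by simp [isContinuation_false_false_iff])]
      simp [shiftZero]
    | succ j =>
      refine continuationWeight_eq_mul ?_ hw
      rw [isContinuation_false_false_iff]
      grind

theorem orderCount_true_succ_succ_succ (a b r : ℕ) :
    orderCount true (a + 1) (b + 1) (r + 1) =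
      orderCount true a (b + 1) (r + 1) + orderCount false (a + 1) b r := by
  cases r <;> simp [orderCount, compositionCount, Nat.choose_succ_succ]
  ring

theorem orderCount_false_succ_succ (a b r : ℕ) :
    orderCount false (a + 1) (b + 1) r =
      orderCount false (a + 1) b r + orderCount true a (b + 1) r := by
  cases r <;> simp [orderCount, compositionCount, Nat.choose_succ_succ]
  ring

theorem continuationProb_serverA (pa pb : ℝ) (a b r j : ℕ) :
    continuationProb pa pb true a b r j =
      pa * shiftZero (fun a => continuationProb pa pb true a b r j) a +
      (1 - pa) * pb *
        shiftZero (fun r => shiftZero (fun b => continuationProb pa pb false a b r j) b) r +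
      (if a = 0 ∧ b = 0 then 0 else (1 - pa) * (1 - pb)) *
        shiftZero (fun j => continuationProb pa pb true a b r j) j := by
  rcases r with _ | r
  · cases a <;> cases j <;> simp [continuationProb, orderCount, shiftZero]
  rcases a with _ | a <;> rcases b with _ | b
  · cases j <;> simp [continuationProb, orderCount, compositionCount, shiftZero]
  · cases r <;> cases j <;>
      simp [continuationProb, orderCount, compositionCount, shiftZero, Nat.multichoose_succ_succ]
    all_goals ring
  · cases j <;> simp [continuationProb, orderCount, compositionCount, shiftZero]
  · have hm : a + 1 + b = a + (b + 1) := by omega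
    have hs : a + 1 + (b + 1) = a + (b + 1) + 1 := by omega
    cases j <;>
      simp [continuationProb, shiftZero, Nat.multichoose_succ_succ,
        orderCount_true_succ_succ_succ, hm, hs]
    all_goals ring

theorem continuationProb_serverB (pa pb : ℝ) (a b r j : ℕ) :
    continuationProb pa pb false a b r j =
      (if a = 0 ∧ b = 0 ∧ r = 0 ∧ j = 0 then 1 else 0) +
      pb * shiftZero (fun b => continuationProb pa pb false a b r j) b +
      (1 - pb) * pa * shiftZero (fun a => continuationProb pa pb true a b r j) a +
      (if a = 0 ∧ b = 0 then 0 else (1 - pa) * (1 - pb)) *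
        shiftZero (fun j => continuationProb pa pb false a b r j) j := by
  rcases a with _ | a <;> rcases b with _ | b
  · cases r <;> cases j <;> simp [continuationProb, orderCount, compositionCount, shiftZero]
  · cases r <;> cases j <;>
      simp [continuationProb, orderCount, compositionCount, shiftZero, Nat.multichoose_succ_succ]
    all_goals ring
  · rcases r with _ | _ | r <;> cases j <;>
      simp [continuationProb, orderCount, compositionCount, shiftZero, Nat.multichoose_succ_succ]
  · have hm : a + 1 + b = a + (b + 1) := by omega
    have hs : a + 1 + (b + 1) = a + (b + 1) + 1 := by omega
    have h0 : orderCount true a (b + 1) 0 = 0 := rfl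
    cases r <;> cases j <;>
      simp [continuationProb, shiftZero, Nat.multichoose_succ_succ,
        orderCount_false_succ_succ, hm, hs, h0]
    all_goals ring

theorem hasSum_shiftZero {F : ℕ → List Bool → ℝ} {p : ℕ → ℝ} (n : ℕ)
    (h : ∀ m < n, HasSum (F m) (p m)) :
    HasSum (fun g => shiftZero (fun m => F m g) n) (shiftZero p n) := by
  cases n with
  | zero => exact hasSum_zero
  | succ n => exact h n n.lt_succ_self

theorem hasSum_continuationWeight (pa pb : ℝ) (srv : Bool) (a b r j : ℕ) :
    HasSum (continuationWeight pa pb srv a b r j) (continuationProb pa pb srv a b r j) := by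
  induction hn : a + b + j using Nat.strong_induction_on generalizing srv a b r j with
  | _ n ih =>
    have hz := (hasSum_shiftZero j fun m hm => ih (a + b + m) (by omega) srv a b r m rfl).mul_left
      (if a = 0 ∧ b = 0 then 0 else (1 - pa) * (1 - pb))
    cases srv with
    | true =>
      have hx := (hasSum_shiftZero a fun m hm =>
        ih (m + b + j) (by omega) true m b r j rfl).mul_left pa
      have hy := (hasSum_shiftZero r fun r' _ => hasSum_shiftZero b fun m hm =>
        ih (a + m + j) (by omega) false a m r' j rfl).mul_left ((1 - pa) * pb)
      simp only [← continuationWeight_true_of_serverA] at hx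
      simp only [← continuationWeight_false_true_of_serverA] at hy
      simp only [← continuationWeight_false_false] at hz
      have h := hasSum_list_bool_pairs (continuationWeight_singleton_false ..) hx hy hz
      rw [continuationProb_serverA]
      simpa [continuationWeight_nil] using h
    | false =>
      have hx := (hasSum_shiftZero b fun m hm =>
        ih (a + m + j) (by omega) false a m r j rfl).mul_left pb
      have hy := (hasSum_shiftZero a fun m hm =>
        ih (m + b + j) (by omega) true m b r j rfl).mul_left ((1 - pb) * pa)
      simp only [← continuationWeight_true_of_serverB] at hx
      simp only [← continuationWeight_false_true_of_serverB] at hy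
      simp only [← continuationWeight_false_false] at hz
      have h := hasSum_list_bool_pairs (continuationWeight_singleton_false ..) hx hy hz
      rw [continuationProb_serverB]
      simpa [continuationWeight_nil] using h

theorem isContinuation_true_iff (a b r j : ℕ) (g : List Bool) :
    IsContinuation true a b r j g ↔
      soScoreA g = a ∧ soScoreB g = b ∧ soLastB g ∧ soInter g = r ∧ exchCount g = j := by
  have h : ((true :: g).getLast? = some true ∧ (true :: soScorers true g).getLast? = some false) ↔
      soLastB g := by
    unfold soLastB
    rcases g with _ | ⟨x, g⟩
    · simp [soScorers]
    · rw [List.getLast?_cons_cons]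
      refine and_congr_right fun _ => ?_
      rcases soScorers true (x :: g) with _ | ⟨y, l⟩
      · simp
      · rw [List.getLast?_cons_cons]
  rw [IsContinuation, h]
  rfl

theorem stmt_1 (α β r j : ℕ) (hβ : 1 ≤ β) (hr1 : 1 ≤ r) (hr2 : r ≤ min α (β - 1) + 1)
    (pa pb : ℝ) (hpa0 : 0 ≤ pa) (hpa1 : pa ≤ 1) (hpb0 : 0 ≤ pb) (hpb1 : pb ≤ 1) :
    soPr pa pb {g : List Bool | soScoreA g = α ∧ soScoreB g = β ∧ soLastB g ∧
        soInter g = r ∧ exchCount g = j} =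
      ((α + β + j - 1).choose j : ℝ) * (α.choose (r - 1) : ℝ) * ((β - 1).choose (r - 1) : ℝ) *
        pa ^ α * pb ^ β * (1 - pa) * ((1 - pa) * (1 - pb)) ^ (r + j - 1) := by
  have h : (Set.indicator {g : List Bool | soScoreA g = α ∧ soScoreB g = β ∧ soLastB g ∧
      soInter g = r ∧ exchCount g = j} (soWeight pa pb true)) =
      continuationWeight pa pb true α β r j := by
    ext g
    simp only [← isContinuation_true_iff, continuationWeight]
    rfl
  rw [soPr, h, (hasSum_continuationWeight pa pb true α β r j).tsum_eq]
  obtain ⟨r, rfl⟩ := Nat.exists_eq_add_of_le' hr1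
  obtain ⟨β, rfl⟩ := Nat.exists_eq_add_of_le' hβ
  simp only [continuationProb, orderCount, compositionCount, Nat.multichoose_eq,
    Nat.add_sub_cancel, if_true, Nat.cast_mul]
  rw [show r + 1 + j - 1 = r + j by omega, mul_pow _ _ j, mul_pow _ _ (r + j), ← add_assoc]
  ring
end

section
/- In a side-out A-game with score (α,β) and A scoring last, the conditional moment generating function of the total number of rallies D is M(t) = ((1-q)e^t / (1 - q e^{2t}))^{α+β} · E[e^{2tR}], where R is the random number of A-interruptions, taking value r ∈ {min(β,1), …, min(α,β)} with probability proportional to C(α,r) C(β-1,r-1) q^r, valid for q e^{2t} < 1. -/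
open scoped BigOperators
open Filter

/-- Rally outcomes, counted from a position in which `srv` serves, that bring A exactly `a` and
B exactly `b` further points and stop right after a point of A; the empty list stops right after
a point of A if `srv = true`. -/
def soReach (srv : Bool) (a b : ℕ) (g : List Bool) : Prop :=
  (soScorers srv g).count true = a ∧ (soScorers srv g).count false = b ∧
    (true :: g).getLast? = some true ∧ (srv :: soScorers srv g).getLast? = some true

open Classical in
/-- Weight of the rally outcomes in `soReach`, with a factor `z` for every rally. -/
noncomputable def soTerm (pa pb z : ℝ) (srv : Bool) (a b : ℕ) (g : List Bool) : ℝ :=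
  if soReach srv a b g then soWeight pa pb srv g * z ^ g.length else 0

/-- Generating function, in the number of blocks of B-points, of the sequences of `a` points of A
and `b` points of B ending with A, where a block at the start is counted only if `srv` holds. -/
def blockGen (x : ℝ) : Bool → ℕ → ℕ → ℝ
  | srv, 0, 0 => if srv then 1 else 0
  | _, a + 1, 0 => blockGen x true a 0
  | srv, 0, b + 1 => (if srv then x else 1) * blockGen x false 0 b
  | srv, a + 1, b + 1 =>
      blockGen x true a (b + 1) + (if srv then x else 1) * blockGen x false (a + 1) b

theorem blockGen_true_zero (x : ℝ) (a : ℕ) : blockGen x true a 0 = 1 := by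
  induction a with
  | zero => simp [blockGen]
  | succ a ih => simp [blockGen, ih]

theorem blockGen_false_zero (x : ℝ) (b : ℕ) : blockGen x false 0 b = 0 := by
  induction b with
  | zero => simp [blockGen]
  | succ b ih => simp [blockGen, ih]

theorem blockGen_false_succ_of_true (x : ℝ) (a : ℕ)
    (h : ∀ b, blockGen x true a (b + 1) =
      ∑ r ∈ Finset.range (b + 1), (a.choose (r + 1) : ℝ) * (b.choose r : ℝ) * x ^ (r + 1))
    (b : ℕ) :
    blockGen x false (a + 1) b =
      ∑ r ∈ Finset.range (b + 1), (a.choose r : ℝ) * (b.choose r : ℝ) * x ^ r := by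
  induction b with
  | zero => simp [blockGen, blockGen_true_zero]
  | succ b ih =>
    have hb : ∑ r ∈ Finset.range (b + 1), (a.choose r : ℝ) * (b.choose r : ℝ) * x ^ r =
        ∑ r ∈ Finset.range (b + 2), (a.choose r : ℝ) * (b.choose r : ℝ) * x ^ r := by
      rw [Finset.sum_range_succ _ (b + 1)]
      simp
    rw [blockGen, h, ih, hb, Finset.sum_range_succ' _ (b + 1), Finset.sum_range_succ' _ (b + 1)]
    simp only [Bool.false_eq_true, if_false, one_mul, Nat.choose_zero_right]
    rw [← add_assoc, ← Finset.sum_add_distrib]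
    congr 1
    refine Finset.sum_congr rfl fun r _ => ?_
    rw [Nat.choose_succ_succ b r]
    push_cast
    ring

theorem blockGen_true_succ (x : ℝ) (a b : ℕ) :
    blockGen x true a (b + 1) =
      ∑ r ∈ Finset.range (b + 1), (a.choose (r + 1) : ℝ) * (b.choose r : ℝ) * x ^ (r + 1) := by
  induction a generalizing b with
  | zero => simp [blockGen, blockGen_false_zero]
  | succ a ih =>
    rw [blockGen, ih, blockGen_false_succ_of_true x a ih, Finset.mul_sum, ← Finset.sum_add_distrib]
    refine Finset.sum_congr rfl fun r _ => ?_
    rw [Nat.choose_succ_succ a r]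
    push_cast
    simp only [if_true]
    ring

theorem blockGen_true_eq_sum (x : ℝ) (a b : ℕ) :
    blockGen x true a b = ∑ r ∈ Finset.Icc (min b 1) (min a b),
      (a.choose r : ℝ) * ((b - 1).choose (r - 1) : ℝ) * x ^ r := by
  cases b with
  | zero => simp [blockGen_true_zero]
  | succ b =>
    rw [blockGen_true_succ, Nat.min_eq_right (by omega : 1 ≤ b + 1)]
    have hsub : Finset.Icc 1 (min a (b + 1)) ⊆ Finset.Ico 1 (b + 2) := by
      intro r hr
      simp only [Finset.mem_Icc, Finset.mem_Ico] at *
      omega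
    rw [Finset.sum_subset hsub, Finset.sum_Ico_eq_sum_range]
    · refine Finset.sum_congr rfl fun r _ => ?_
      simp [add_comm 1 r]
    · intro r hr hr'
      simp only [Finset.mem_Icc, Finset.mem_Ico] at hr hr'
      rw [Nat.choose_eq_zero_of_lt (by omega : a < r)]
      simp

theorem blockGen_true_pos {x : ℝ} (hx : 0 < x) (a b : ℕ) (ha : 1 ≤ a) :
    0 < blockGen x true a b := by
  rw [blockGen_true_eq_sum x a b]
  refine Finset.sum_pos (fun r hr => ?_) ⟨min b 1, by simp; omega⟩
  simp only [Finset.mem_Icc] at hr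
  have h₁ : 0 < a.choose r := Nat.choose_pos (by omega)
  have h₂ : 0 < (b - 1).choose (r - 1) := Nat.choose_pos (by omega)
  positivity

section Trajectories

variable {pa pb z : ℝ}

theorem soTerm_nonneg (ha0 : 0 ≤ pa) (ha1 : pa ≤ 1) (hb0 : 0 ≤ pb) (hb1 : pb ≤ 1)
    (hz : 0 ≤ z) (srv : Bool) (a b : ℕ) (g : List Bool) : 0 ≤ soTerm pa pb z srv a b g := by
  have hw : ∀ srv, 0 ≤ soWeight pa pb srv g := by
    induction g with
    | nil => intro srv; simp [soWeight]
    | cons s g ih =>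
      intro srv
      rw [soWeight]
      refine mul_nonneg ?_ (ih _)
      split_ifs <;> linarith
  unfold soTerm
  split_ifs
  · exact mul_nonneg (hw srv) (pow_nonneg hz _)
  · exact le_rfl

theorem soReach_false_cons {srv : Bool} {a b : ℕ} (hab : a + b ≠ 0) (g : List Bool) :
    soReach srv a b (false :: g) ↔ soReach (!srv) a b g := by
  have hs : soScorers srv (false :: g) = soScorers (!srv) g := by simp [soScorers]
  unfold soReach
  rw [hs]
  cases g with
  | nil => simp [soScorers]; omega
  | cons s g =>
    cases h : soScorers (!srv) (s :: g) with
    | nil => simp; omega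
    | cons c l => simp [List.getLast?_cons_cons]

theorem soTerm_false_cons {srv : Bool} {a b : ℕ} (hab : a + b ≠ 0) (g : List Bool) :
    soTerm pa pb z srv a b (false :: g) =
      (1 - if srv then pa else pb) * z * soTerm pa pb z (!srv) a b g := by
  by_cases hg : soReach (!srv) a b g
  · rw [soTerm, soTerm, if_pos hg, if_pos ((soReach_false_cons hab g).2 hg)]
    cases srv <;> simp [soWeight, pow_succ] <;> ring
  · rw [soTerm, soTerm, if_neg hg, if_neg (mt (soReach_false_cons hab g).1 hg), mul_zero]

theorem soTerm_replicate_even {srv : Bool} {a b : ℕ} (hab : a + b ≠ 0) (j : ℕ) (g : List Bool) :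
    soTerm pa pb z srv a b (List.replicate (2 * j) false ++ g) =
      ((1 - pa) * (1 - pb) * z ^ 2) ^ j * soTerm pa pb z srv a b g := by
  induction j with
  | zero => simp
  | succ j ih =>
    rw [show 2 * (j + 1) = 2 * j + 1 + 1 by ring, List.replicate_succ, List.replicate_succ,
      List.cons_append, List.cons_append, soTerm_false_cons hab, soTerm_false_cons hab,
      Bool.not_not, ih]
    cases srv <;> simp <;> ring

theorem soTerm_replicate_odd {srv : Bool} {a b : ℕ} (hab : a + b ≠ 0) (j : ℕ) (g : List Bool) :
    soTerm pa pb z srv a b (List.replicate (2 * j + 1) false ++ g) =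
      ((1 - pa) * (1 - pb) * z ^ 2) ^ j *
        ((1 - if srv then pa else pb) * z * soTerm pa pb z (!srv) a b g) := by
  rw [List.replicate_succ, List.cons_append, soTerm_false_cons hab, soTerm_replicate_even hab]
  ring

theorem replicate_false_append_injective :
    Function.Injective fun y : ℕ × List Bool => List.replicate y.1 false ++ true :: y.2 := by
  rintro ⟨k, g⟩ ⟨l, h⟩ hkl
  simp only at hkl
  induction k generalizing l with
  | zero =>
    cases l with
    | zero => simpa using hkl
    | succ l => simp [List.replicate_succ] at hkl
  | succ k ih =>
    cases l with
    | zero => simp [List.replicate_succ] at hkl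
    | succ l =>
      simp only [List.replicate_succ, List.cons_append, List.cons.injEq, true_and] at hkl
      simpa using ih l hkl

theorem exists_replicate_false_append (g : List Bool) (hg : true ∈ g) :
    ∃ y : ℕ × List Bool, List.replicate y.1 false ++ true :: y.2 = g := by
  induction g with
  | nil => simp at hg
  | cons s g ih =>
    cases s with
    | true => exact ⟨(0, g), by simp⟩
    | false =>
      obtain ⟨⟨k, h⟩, hk⟩ := ih (by simpa using hg)
      exact ⟨(k + 1, h), by simpa [List.replicate_succ] using hk⟩

theorem soTerm_eq_zero_of_notMem {srv : Bool} {a b : ℕ} (hab : a + b ≠ 0) {g : List Bool}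
    (hg : true ∉ g) : soTerm pa pb z srv a b g = 0 := by
  refine if_neg fun h => ?_
  cases g with
  | nil => obtain ⟨h₁, h₂, -⟩ := h; simp [soScorers] at h₁ h₂; omega
  | cons s g =>
    have h₃ := h.2.2.1
    rw [List.getLast?_cons_cons] at h₃
    exact hg (List.mem_of_getLast? h₃)

/-- Summation over the rallies up to the first point. -/
theorem hasSum_soTerm_of_first_point (ha0 : 0 ≤ pa) (ha1 : pa ≤ 1) (hb0 : 0 ≤ pb) (hb1 : pb ≤ 1)
    (hz : 0 ≤ z) (hx : (1 - pa) * (1 - pb) * z ^ 2 < 1) {srv : Bool} {a b : ℕ} (hab : a + b ≠ 0)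
    {s t : ℝ} (hs : HasSum (fun g => soTerm pa pb z srv a b (true :: g)) s)
    (ht : HasSum (fun g => soTerm pa pb z (!srv) a b (true :: g)) t) :
    HasSum (soTerm pa pb z srv a b)
      ((s + (1 - if srv then pa else pb) * z * t) / (1 - (1 - pa) * (1 - pb) * z ^ 2)) := by
  have hx0 : 0 ≤ (1 - pa) * (1 - pb) * z ^ 2 :=
    mul_nonneg (mul_nonneg (by linarith) (by linarith)) (sq_nonneg z)
  have hgeo := hasSum_geometric_of_lt_one hx0 hx
  have heven : HasSum (fun k : ℕ => if Even k then ((1 - pa) * (1 - pb) * z ^ 2) ^ (k / 2) else 0)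
      (1 - (1 - pa) * (1 - pb) * z ^ 2)⁻¹ := by
    rw [← add_zero (1 - (1 - pa) * (1 - pb) * z ^ 2)⁻¹]
    refine HasSum.even_add_odd (by simpa using hgeo) ?_
    simp
  have hodd : HasSum (fun k : ℕ => if Even k then 0 else ((1 - pa) * (1 - pb) * z ^ 2) ^ (k / 2))
      (1 - (1 - pa) * (1 - pb) * z ^ 2)⁻¹ := by
    rw [← zero_add (1 - (1 - pa) * (1 - pb) * z ^ 2)⁻¹]
    refine HasSum.even_add_odd (by simp) ?_
    have hdiv : ∀ j : ℕ, (2 * j + 1) / 2 = j := fun j => by omega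
    simpa [hdiv] using hgeo
  have ht' := ht.mul_left ((1 - if srv then pa else pb) * z)
  have hc : 0 ≤ (1 - if srv then pa else pb) * z := by
    refine mul_nonneg ?_ hz
    split_ifs <;> linarith
  have hprod₁ := heven.mul hs (heven.summable.mul_of_nonneg hs.summable
    (fun k => by dsimp only [Pi.zero_apply]; split_ifs <;> positivity)
    (fun g => soTerm_nonneg ha0 ha1 hb0 hb1 hz _ _ _ _))
  have hprod₂ := hodd.mul ht' (hodd.summable.mul_of_nonneg ht'.summable
    (fun k => by dsimp only [Pi.zero_apply]; split_ifs <;> positivity)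
    (fun g => mul_nonneg hc (soTerm_nonneg ha0 ha1 hb0 hb1 hz _ _ _ _)))
  rw [← replicate_false_append_injective.hasSum_iff (fun g hg => soTerm_eq_zero_of_notMem hab
    fun hmem => hg (exists_replicate_false_append g hmem))]
  have hval : (s + (1 - if srv then pa else pb) * z * t) / (1 - (1 - pa) * (1 - pb) * z ^ 2) =
      (1 - (1 - pa) * (1 - pb) * z ^ 2)⁻¹ * s +
        (1 - (1 - pa) * (1 - pb) * z ^ 2)⁻¹ * ((1 - if srv then pa else pb) * z * t) := by
    rw [div_eq_inv_mul, mul_add]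
  rw [hval]
  refine (hprod₁.add hprod₂).congr_fun ?_
  rintro ⟨k, g⟩
  rcases Nat.even_or_odd' k with ⟨j, rfl | rfl⟩
  · simp [soTerm_replicate_even hab]
  · have hdiv : (2 * j + 1) / 2 = j := by omega
    simp [soTerm_replicate_odd hab, hdiv]

theorem soTerm_true_cons_true_zero (b : ℕ) (g : List Bool) :
    soTerm pa pb z true 0 b (true :: g) = 0 := by
  simp [soTerm, soReach, soScorers]

theorem soTerm_true_cons_true_succ (a b : ℕ) (g : List Bool) :
    soTerm pa pb z true (a + 1) b (true :: g) = pa * z * soTerm pa pb z true a b g := by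
  have h : soReach true (a + 1) b (true :: g) ↔ soReach true a b g := by
    simp [soReach, soScorers, List.getLast?_cons_cons]
  by_cases hg : soReach true a b g
  · rw [soTerm, soTerm, if_pos hg, if_pos (h.2 hg)]
    simp [soWeight, pow_succ]
    ring
  · rw [soTerm, soTerm, if_neg hg, if_neg (mt h.1 hg), mul_zero]

theorem soTerm_true_cons_false_zero (a : ℕ) (g : List Bool) :
    soTerm pa pb z false a 0 (true :: g) = 0 := by
  simp [soTerm, soReach, soScorers]

theorem soTerm_true_cons_false_succ (a b : ℕ) (g : List Bool) :
    soTerm pa pb z false a (b + 1) (true :: g) = pb * z * soTerm pa pb z false a b g := by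
  have h : soReach false a (b + 1) (true :: g) ↔ soReach false a b g := by
    simp [soReach, soScorers, List.getLast?_cons_cons]
  by_cases hg : soReach false a b g
  · rw [soTerm, soTerm, if_pos hg, if_pos (h.2 hg)]
    simp [soWeight, pow_succ]
    ring
  · rw [soTerm, soTerm, if_neg hg, if_neg (mt h.1 hg), mul_zero]

theorem soReach_zero_zero (srv : Bool) (g : List Bool) :
    soReach srv 0 0 g ↔ g = [] ∧ srv = true := by
  constructor
  · rintro ⟨h₁, h₂, h₃, h₄⟩
    have hs : soScorers srv g = [] := by
      refine List.eq_nil_iff_forall_not_mem.2 fun c hc => ?_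
      cases c
      · exact List.count_eq_zero.1 h₂ hc
      · exact List.count_eq_zero.1 h₁ hc
    have hmem : ∀ g srv, true ∈ g → soScorers srv g ≠ [] := by
      intro g
      induction g with
      | nil => simp
      | cons s g ih => cases s <;> simp_all [soScorers]
    rw [hs] at h₄
    refine ⟨?_, by simpa using h₄⟩
    cases g with
    | nil => rfl
    | cons s g =>
      rw [List.getLast?_cons_cons] at h₃
      exact absurd hs (hmem _ _ (List.mem_of_getLast? h₃))
  · rintro ⟨rfl, rfl⟩
    simp [soReach, soScorers]

theorem hasSum_soTerm (ha0 : 0 ≤ pa) (ha1 : pa ≤ 1) (hb0 : 0 ≤ pb) (hb1 : pb ≤ 1)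
    (hz : 0 ≤ z) (hx : (1 - pa) * (1 - pb) * z ^ 2 < 1) (srv : Bool) (a b : ℕ) :
    HasSum (soTerm pa pb z srv a b)
      ((if srv then 1 else (1 - pb) * z) * (pa * z / (1 - (1 - pa) * (1 - pb) * z ^ 2)) ^ a *
        (pb * z / (1 - (1 - pa) * (1 - pb) * z ^ 2)) ^ b *
          blockGen ((1 - pa) * (1 - pb) * z ^ 2) srv a b) := by
  have zeroA (b : ℕ) : HasSum (fun g => soTerm pa pb z true 0 b (true :: g)) 0 := by
    simpa only [soTerm_true_cons_true_zero] using hasSum_zero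
  have zeroB (a : ℕ) : HasSum (fun g => soTerm pa pb z false a 0 (true :: g)) 0 := by
    simpa only [soTerm_true_cons_false_zero] using hasSum_zero
  have succA {a b : ℕ} {s : ℝ} (h : HasSum (soTerm pa pb z true a b) s) :
      HasSum (fun g => soTerm pa pb z true (a + 1) b (true :: g)) (pa * z * s) := by
    simpa only [soTerm_true_cons_true_succ] using h.mul_left (pa * z)
  have succB {a b : ℕ} {s : ℝ} (h : HasSum (soTerm pa pb z false a b) s) :
      HasSum (fun g => soTerm pa pb z false a (b + 1) (true :: g)) (pb * z * s) := by
    simpa only [soTerm_true_cons_false_succ] using h.mul_left (pb * z)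
  have step {a b : ℕ} (hab : a + b ≠ 0) {s t : ℝ} (srv : Bool)
      (hs : HasSum (fun g => soTerm pa pb z true a b (true :: g)) s)
      (ht : HasSum (fun g => soTerm pa pb z false a b (true :: g)) t) :
      HasSum (soTerm pa pb z srv a b)
        ((if srv then s + (1 - pa) * z * t else t + (1 - pb) * z * s) /
          (1 - (1 - pa) * (1 - pb) * z ^ 2)) := by
    cases srv
    · simpa using hasSum_soTerm_of_first_point ha0 ha1 hb0 hb1 hz hx hab ht hs
    · simpa using hasSum_soTerm_of_first_point ha0 ha1 hb0 hb1 hz hx hab hs ht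
  induction a generalizing b srv with
  | zero =>
    induction b generalizing srv with
    | zero =>
      convert hasSum_single (f := soTerm pa pb z srv 0 0) [] ?_ using 1
      · cases srv <;> simp [soTerm, soReach_zero_zero, soWeight, blockGen]
      · intro g hg
        simp [soTerm, soReach_zero_zero, hg]
    | succ b ihb =>
      convert step (by omega) srv (zeroA (b + 1)) (succB (ihb false)) using 1
      cases srv <;> simp [blockGen, blockGen_false_zero]
  | succ a iha =>
    induction b generalizing srv with
    | zero =>
      convert step (by omega) srv (succA (iha true 0)) (zeroB (a + 1)) using 1
      cases srv <;> simp only [blockGen, if_true, if_false, Bool.false_eq_true] <;> ring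
    | succ b ihb =>
      convert step (by omega) srv (succA (iha true (b + 1))) (succB (ihb false)) using 1
      cases srv <;> simp only [blockGen, if_true, if_false, Bool.false_eq_true] <;> ring

theorem soReach_true_iff {a b : ℕ} (ha : 1 ≤ a) (g : List Bool) :
    soReach true a b g ↔ soScoreA g = a ∧ soScoreB g = b ∧ soLastA g := by
  unfold soReach soScoreA soScoreB soLastA
  cases g with
  | nil => simp [soScorers]; omega
  | cons s g =>
    cases h : soScorers true (s :: g) with
    | nil => simp; omega
    | cons c l => simp [List.getLast?_cons_cons]

theorem tsum_indicator_soWeight (ha0 : 0 ≤ pa) (ha1 : pa ≤ 1) (hb0 : 0 ≤ pb) (hb1 : pb ≤ 1)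
    (hz : 0 ≤ z) (hx : (1 - pa) * (1 - pb) * z ^ 2 < 1) {a : ℕ} (ha : 1 ≤ a) (b : ℕ) :
    ∑' g : List Bool, Set.indicator {g | soScoreA g = a ∧ soScoreB g = b ∧ soLastA g}
        (fun g => soWeight pa pb true g * z ^ g.length) g =
      (pa * z / (1 - (1 - pa) * (1 - pb) * z ^ 2)) ^ a *
        (pb * z / (1 - (1 - pa) * (1 - pb) * z ^ 2)) ^ b *
          blockGen ((1 - pa) * (1 - pb) * z ^ 2) true a b := by
  have h := (hasSum_soTerm ha0 ha1 hb0 hb1 hz hx true a b).tsum_eq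
  rw [if_pos rfl, one_mul] at h
  rw [← h]
  refine tsum_congr fun g => ?_
  classical
  rw [Set.indicator_apply, soTerm]
  simp only [Set.mem_ofPred_eq, soReach_true_iff ha]

end Trajectories

theorem stmt_4 (α β : ℕ) (hα : 1 ≤ α) (pa pb : ℝ) (hpa0 : 0 < pa) (hpa1 : pa < 1)
    (hpb0 : 0 < pb) (hpb1 : pb < 1) (t : ℝ)
    (ht : (1 - pa) * (1 - pb) * Real.exp (2 * t) < 1) :
    soCondExp pa pb {g : List Bool | soScoreA g = α ∧ soScoreB g = β ∧ soLastA g}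
        (fun g => Real.exp (t * (g.length : ℝ))) =
      ((1 - (1 - pa) * (1 - pb)) * Real.exp t /
          (1 - (1 - pa) * (1 - pb) * Real.exp (2 * t))) ^ (α + β) *
        ((∑ r ∈ Finset.Icc (min β 1) (min α β),
            Real.exp (2 * t * (r : ℝ)) *
              ((α.choose r : ℝ) * ((β - 1).choose (r - 1) : ℝ) * ((1 - pa) * (1 - pb)) ^ r)) /
          (∑ r ∈ Finset.Icc (min β 1) (min α β),
            (α.choose r : ℝ) * ((β - 1).choose (r - 1) : ℝ) * ((1 - pa) * (1 - pb)) ^ r)) := by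
  have hq0 : 0 < (1 - pa) * (1 - pb) := mul_pos (by linarith) (by linarith)
  have hq1 : (1 - pa) * (1 - pb) < 1 := by nlinarith
  have hexp : Real.exp (2 * t) = Real.exp t ^ 2 := by rw [← Real.exp_nat_mul]; norm_num
  have hlen (g : List Bool) : Real.exp (t * (g.length : ℝ)) = Real.exp t ^ g.length := by
    rw [mul_comm, Real.exp_nat_mul]
  have hnum := tsum_indicator_soWeight hpa0.le hpa1.le hpb0.le hpb1.le (Real.exp_pos t).le
    (by rwa [← hexp]) hα β
  have hden := tsum_indicator_soWeight hpa0.le hpa1.le hpb0.le hpb1.le zero_le_one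
    (by simpa using hq1) hα β
  simp only [one_pow, mul_one] at hden
  have hsum : ∑ r ∈ Finset.Icc (min β 1) (min α β), Real.exp (2 * t * (r : ℝ)) *
      ((α.choose r : ℝ) * ((β - 1).choose (r - 1) : ℝ) * ((1 - pa) * (1 - pb)) ^ r) =
      blockGen ((1 - pa) * (1 - pb) * Real.exp t ^ 2) true α β := by
    rw [blockGen_true_eq_sum]
    refine Finset.sum_congr rfl fun r _ => ?_
    rw [mul_comm (2 * t), Real.exp_nat_mul, hexp, mul_pow _ (Real.exp t ^ 2)]
    ring
  have hpos := blockGen_true_pos hq0 α β hα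
  unfold soCondExp soPr
  rw [hsum, ← blockGen_true_eq_sum]
  simp only [hlen]
  rw [hnum, hden, ← hexp]
  have h₁ : 1 - (1 - pa) * (1 - pb) ≠ 0 := by linarith
  have h₂ : 1 - (1 - pa) * (1 - pb) * Real.exp (2 * t) ≠ 0 := by linarith
  have h₃ := hpos.ne'
  have h₄ := hpa0.ne'
  have h₅ := hpb0.ne'
  have hratio (p : ℝ) (hp : p ≠ 0) (n : ℕ) :
      (p * Real.exp t / (1 - (1 - pa) * (1 - pb) * Real.exp (2 * t))) ^ n =
        ((1 - (1 - pa) * (1 - pb)) * Real.exp t /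
          (1 - (1 - pa) * (1 - pb) * Real.exp (2 * t))) ^ n *
          (p / (1 - (1 - pa) * (1 - pb))) ^ n := by
    rw [← mul_pow]
    congr 1
    field_simp
  rw [hratio pa h₄, hratio pb h₅, pow_add]
  have h₆ : (pa / (1 - (1 - pa) * (1 - pb))) ^ α ≠ 0 := pow_ne_zero _ (div_ne_zero h₄ h₁)
  have h₇ : (pb / (1 - (1 - pa) * (1 - pb))) ^ β ≠ 0 := pow_ne_zero _ (div_ne_zero h₅ h₁)
  generalize (pa / (1 - (1 - pa) * (1 - pb))) ^ α = u at *
  generalize (pb / (1 - (1 - pa) * (1 - pb))) ^ β = v at *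
  field_simp
end

section
/- Conditional on an A-served side-out game ending at score (α,β) with A scoring last, the expected number of rallies equals (α+β)(1+q)/(1-q) + 2·E[R], where q = (1-p_a)(1-p_b) and R is the number of A-interruptions with P[R=r] proportional to C(α,r) C(β-1,r-1) q^r over r ∈ {min(β,1),…,min(α,β)}. -/
open scoped BigOperators
open Filter

section

open Finset

/-- The trajectory `g`, started with server `srv`, yields `a` points for A and `b` points for B
and does not continue after the last point, which is won by A.  The empty trajectory qualifies
when A is serving, so that the predicate is stable under removing a point from the front. -/
def SoEnds (srv : Bool) (a b : ℕ) (g : List Bool) : Prop :=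
  (soScorers srv g).count true = a ∧ (soScorers srv g).count false = b ∧
    g.getLast? ≠ some false ∧ (soScorers srv g).getLast?.getD srv = true

open Classical in
/-- Weight of a trajectory restricted to `SoEnds`. -/
noncomputable def soEndWeight (pa pb : ℝ) (srv : Bool) (a b : ℕ) (g : List Bool) : ℝ :=
  if SoEnds srv a b g then soWeight pa pb srv g else 0

theorem soEnds_true_cons_succ (a b : ℕ) (t : List Bool) :
    SoEnds true (a + 1) b (true :: t) ↔ SoEnds true a b t := by
  rcases t with _ | ⟨s, t⟩
  · simp only [SoEnds, soScorers]
    simpa using fun _ => eq_comm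
  · simp [SoEnds, soScorers, List.getLast?_cons]

theorem soEnds_false_cons_succ (a b : ℕ) (t : List Bool) :
    SoEnds false a (b + 1) (true :: t) ↔ SoEnds false a b t := by
  rcases t with _ | ⟨s, t⟩ <;> simp [SoEnds, soScorers, List.getLast?_cons]

theorem not_soEnds_false_zero_cons (a : ℕ) (t : List Bool) :
    ¬ SoEnds false a 0 (true :: t) := by
  simp [SoEnds, soScorers]

theorem soEnds_cons_false (srv : Bool) (a b : ℕ) (t : List Bool) :
    SoEnds srv (a + 1) b (false :: t) ↔ SoEnds (!srv) (a + 1) b t := by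
  rcases t with _ | ⟨s, t⟩
  · simp [SoEnds, soScorers]
  · have h : soScorers srv (false :: s :: t) = soScorers (!srv) (s :: t) := by
      simp [soScorers]
    simp only [SoEnds, h, List.getLast?_cons_cons]
    rcases soScorers (!srv) (s :: t) with _ | ⟨u, l⟩ <;> simp [List.getLast?_cons]

theorem not_soEnds_succ_nil (srv : Bool) (a b : ℕ) : ¬ SoEnds srv (a + 1) b [] := by
  simp [SoEnds, soScorers]

theorem eq_nil_of_soScorers_eq_nil : ∀ (g : List Bool) (srv : Bool),
    soScorers srv g = [] → g.getLast? ≠ some false → g = []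
  | [], _, _, _ => rfl
  | true :: t, srv, h, _ => by simp [soScorers] at h
  | [false], _, _, h => by simp at h
  | false :: s :: t, srv, h, h' => by
      have := eq_nil_of_soScorers_eq_nil (s :: t) (!srv) (by simpa [soScorers] using h)
        (by simpa using h')
      simp at this

theorem soEnds_true_zero (b : ℕ) (g : List Bool) :
    SoEnds true 0 b g ↔ g = [] ∧ b = 0 := by
  constructor
  · rintro ⟨h1, h2, h3, h4⟩
    have hs : soScorers true g = [] := by
      by_contra hne
      rw [List.getLast?_eq_some_getLast hne, Option.getD_some] at h4
      have hmem := List.getLast_mem hne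
      rw [h4] at hmem
      rw [List.count_eq_zero] at h1
      exact h1 hmem
    refine ⟨eq_nil_of_soScorers_eq_nil g true hs h3, ?_⟩
    simpa [hs] using h2.symm
  · rintro ⟨rfl, rfl⟩
    simp [SoEnds, soScorers]

theorem soEnds_true_iff (a b : ℕ) (g : List Bool) :
    SoEnds true (a + 1) b g ↔ soScoreA g = a + 1 ∧ soScoreB g = b ∧ soLastA g := by
  unfold SoEnds soScoreA soScoreB soLastA
  rcases List.eq_nil_or_concat g with rfl | ⟨l, x, rfl⟩
  · simp [soScorers]
  · rcases h : soScorers true (l.concat x) with _ | ⟨u, m⟩ <;>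
      simp [List.getLast?_cons]

section recursion

variable (pa pb : ℝ)

theorem soEndWeight_true_zero (b : ℕ) (g : List Bool) :
    soEndWeight pa pb true 0 b g = if g = [] ∧ b = 0 then 1 else 0 := by
  simp only [soEndWeight, soEnds_true_zero]
  split_ifs with h
  · simp [h.1, soWeight]
  · rfl

theorem soEndWeight_true_cons (a b : ℕ) (t : List Bool) :
    soEndWeight pa pb true (a + 1) b (true :: t) = pa * soEndWeight pa pb true a b t := by
  rw [soEndWeight, soEndWeight, mul_ite, mul_zero]
  classical exact if_congr (soEnds_true_cons_succ a b t) (by simp [soWeight]) rfl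

theorem soEndWeight_true_cons_false (a b : ℕ) (t : List Bool) :
    soEndWeight pa pb true (a + 1) b (false :: t) =
      (1 - pa) * soEndWeight pa pb false (a + 1) b t := by
  rw [soEndWeight, soEndWeight, mul_ite, mul_zero]
  classical exact if_congr (soEnds_cons_false _ a b t) (by simp [soWeight]) rfl

theorem soEndWeight_false_cons_false (a b : ℕ) (t : List Bool) :
    soEndWeight pa pb false (a + 1) b (false :: t) =
      (1 - pb) * soEndWeight pa pb true (a + 1) b t := by
  rw [soEndWeight, soEndWeight, mul_ite, mul_zero]
  classical exact if_congr (soEnds_cons_false _ a b t) (by simp [soWeight]) rfl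

theorem soEndWeight_false_cons (a b : ℕ) (t : List Bool) :
    soEndWeight pa pb false a (b + 1) (true :: t) = pb * soEndWeight pa pb false a b t := by
  rw [soEndWeight, soEndWeight, mul_ite, mul_zero]
  classical exact if_congr (soEnds_false_cons_succ a b t) (by simp [soWeight]) rfl

theorem soEndWeight_false_zero_cons (a : ℕ) (t : List Bool) :
    soEndWeight pa pb false a 0 (true :: t) = 0 := by
  simp [soEndWeight, not_soEnds_false_zero_cons]

theorem soEndWeight_succ_nil (srv : Bool) (a b : ℕ) :
    soEndWeight pa pb srv (a + 1) b [] = 0 := by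
  simp [soEndWeight, not_soEnds_succ_nil]

end recursion

theorem soWeight_nonneg {pa pb : ℝ} (hpa0 : 0 ≤ pa) (hpa1 : pa ≤ 1) (hpb0 : 0 ≤ pb)
    (hpb1 : pb ≤ 1) (g : List Bool) (srv : Bool) : 0 ≤ soWeight pa pb srv g := by
  induction g generalizing srv with
  | nil => simp [soWeight]
  | cons s t ih =>
    rw [soWeight]
    refine mul_nonneg ?_ (ih _)
    split_ifs <;> linarith

theorem soEndWeight_nonneg {pa pb : ℝ} (hpa0 : 0 ≤ pa) (hpa1 : pa ≤ 1) (hpb0 : 0 ≤ pb)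
    (hpb1 : pb ≤ 1) (srv : Bool) (a b : ℕ) (g : List Bool) :
    0 ≤ soEndWeight pa pb srv a b g := by
  unfold soEndWeight
  split_ifs
  · exact soWeight_nonneg hpa0 hpa1 hpb0 hpb1 g srv
  · exact le_rfl

/-- The lists of booleans of length less than `n`. -/
def boolListsLT : ℕ → Finset (List Bool)
  | 0 => ∅
  | n + 1 => insert [] ((boolListsLT n).image (List.cons true) ∪
      (boolListsLT n).image (List.cons false))

theorem mem_boolListsLT {n : ℕ} {g : List Bool} : g ∈ boolListsLT n ↔ g.length < n := by
  induction n generalizing g with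
  | zero => simp [boolListsLT]
  | succ n ih => rcases g with _ | ⟨_ | _, t⟩ <;> simp [boolListsLT, ih]

theorem sum_boolListsLT_succ (n : ℕ) (f : List Bool → ℝ) :
    ∑ g ∈ boolListsLT (n + 1), f g =
      f [] + (∑ t ∈ boolListsLT n, f (true :: t) + ∑ t ∈ boolListsLT n, f (false :: t)) := by
  rw [boolListsLT, sum_insert (by simp), sum_union, sum_image (by simp), sum_image (by simp)]
  rw [disjoint_left]
  simp

theorem summable_of_sum_boolListsLT_le {f : List Bool → ℝ} (hf : ∀ g, 0 ≤ f g) {c : ℝ}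
    (h : ∀ n, ∑ g ∈ boolListsLT n, f g ≤ c) : Summable f := by
  refine summable_of_sum_le (c := c) hf fun u => ?_
  refine le_trans (sum_le_sum_of_subset_of_nonneg (t := boolListsLT (u.sup List.length + 1))
    (fun g hg => ?_) fun g _ _ => hf g) (h _)
  exact mem_boolListsLT.2 (Nat.lt_succ_of_le (le_sup (f := List.length) hg))

theorem HasSum.list_bool {f : List Bool → ℝ} {x y : ℝ}
    (ht : HasSum (fun t => f (true :: t)) x) (hf : HasSum (fun t => f (false :: t)) y) :
    HasSum f (f [] + x + y) := by
  have h0 : HasSum (fun g : List Bool => if g = [] then f [] else 0) (f []) := by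
    simpa using hasSum_ite_eq ([] : List Bool) (f [])
  have h1 : HasSum (fun g : List Bool => if g.head? = some true then f g else 0) x := by
    rw [← (List.cons_injective (a := true)).hasSum_iff]
    · simpa [Function.comp_def] using ht
    · rintro (_ | ⟨_ | _, t⟩) hg <;> simp_all
  have h2 : HasSum (fun g : List Bool => if g.head? = some false then f g else 0) y := by
    rw [← (List.cons_injective (a := false)).hasSum_iff]
    · simpa [Function.comp_def] using hf
    · rintro (_ | ⟨_ | _, t⟩) hg <;> simp_all
  convert (h0.add h1).add h2 using 1
  funext g
  rcases g with _ | ⟨_ | _, t⟩ <;> simp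

section sums

variable {pa pb : ℝ}

theorem sum_soEndWeight_le (hpa0 : 0 ≤ pa) (hpa1 : pa ≤ 1) (hpb0 : 0 ≤ pb) (hpb1 : pb ≤ 1)
    (n : ℕ) :
    (∀ a b, ∑ g ∈ boolListsLT n, soEndWeight pa pb true a b g ≤ 1) ∧
      ∀ a b, ∑ g ∈ boolListsLT n, soEndWeight pa pb false (a + 1) b g ≤ 1 := by
  induction n with
  | zero => simp [boolListsLT]
  | succ n ih =>
    obtain ⟨ihA, ihB⟩ := ih
    constructor
    · rintro (_ | a) b
      · simp only [soEndWeight_true_zero, sum_boolListsLT_succ]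
        by_cases hb : b = 0 <;> simp [hb]
      · simp only [sum_boolListsLT_succ, soEndWeight_true_cons, soEndWeight_true_cons_false,
          soEndWeight_succ_nil, ← mul_sum]
        nlinarith [ihA a b, ihB a b]
    · rintro a (_ | b)
      · simp only [sum_boolListsLT_succ, soEndWeight_false_zero_cons,
          soEndWeight_false_cons_false, soEndWeight_succ_nil, ← mul_sum, sum_const_zero]
        nlinarith [ihA (a + 1) 0]
      · simp only [sum_boolListsLT_succ, soEndWeight_false_cons,
          soEndWeight_false_cons_false, soEndWeight_succ_nil, ← mul_sum]
        nlinarith [ihA (a + 1) (b + 1), ihB a b]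

theorem sum_soEndWeight_mul_length_le {m : ℝ} (hm : 0 < m) (hma : m ≤ pa) (hpa1 : pa ≤ 1)
    (hmb : m ≤ pb) (hpb1 : pb ≤ 1) (n : ℕ) :
    (∀ a b : ℕ, m * ∑ g ∈ boolListsLT n, soEndWeight pa pb true a b g * g.length ≤ a + b) ∧
      ∀ a b : ℕ, m * ∑ g ∈ boolListsLT n, soEndWeight pa pb false (a + 1) b g * g.length
        ≤ a + 1 + b := by
  have hpa0 := hm.le.trans hma
  have hpb0 := hm.le.trans hmb
  induction n with
  | zero =>
    simp only [boolListsLT, sum_empty, mul_zero]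
    exact ⟨fun a b => by positivity, fun a b => by positivity⟩
  | succ n ih =>
    obtain ⟨ihA, ihB⟩ := ih
    obtain ⟨wA, wB⟩ := sum_soEndWeight_le hpa0 hpa1 hpb0 hpb1 n
    constructor
    · rintro (_ | a) b
      · simp only [soEndWeight_true_zero, sum_boolListsLT_succ]
        simp
      · simp only [sum_boolListsLT_succ, soEndWeight_true_cons, soEndWeight_true_cons_false,
          soEndWeight_succ_nil, List.length_cons, Nat.cast_add, Nat.cast_one, mul_add, mul_one,
          sum_add_distrib, mul_assoc, ← mul_sum]
        nlinarith [mul_le_mul_of_nonneg_left (ihA a b) hpa0,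
          mul_le_mul_of_nonneg_left (ihB a b) (sub_nonneg.2 hpa1),
          mul_le_mul_of_nonneg_left (wA a b) (mul_nonneg hm.le hpa0),
          mul_le_mul_of_nonneg_left (wB a b) (mul_nonneg hm.le (sub_nonneg.2 hpa1))]
    · rintro a (_ | b)
      · simp only [sum_boolListsLT_succ, soEndWeight_false_zero_cons,
          soEndWeight_false_cons_false, soEndWeight_succ_nil, zero_mul, sum_const_zero,
          List.length_cons, Nat.cast_add, Nat.cast_one, mul_add, mul_one,
          sum_add_distrib, mul_assoc, ← mul_sum]
        have h := ihA (a + 1) 0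
        push_cast at h ⊢
        nlinarith [mul_le_mul_of_nonneg_left h (sub_nonneg.2 hpb1),
          mul_le_mul_of_nonneg_left (wA (a + 1) 0) (mul_nonneg hm.le (sub_nonneg.2 hpb1)),
          mul_nonneg hpb0 (Nat.cast_nonneg (α := ℝ) a), mul_nonneg hm.le hpb0]
      · simp only [sum_boolListsLT_succ, soEndWeight_false_cons,
          soEndWeight_false_cons_false, soEndWeight_succ_nil,
          List.length_cons, Nat.cast_add, Nat.cast_one, mul_add, mul_one,
          sum_add_distrib, mul_assoc, ← mul_sum]
        have h := ihA (a + 1) (b + 1)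
        push_cast at h
        nlinarith [mul_le_mul_of_nonneg_left (ihB a b) hpb0,
          mul_le_mul_of_nonneg_left h (sub_nonneg.2 hpb1),
          mul_le_mul_of_nonneg_left (wB a b) (mul_nonneg hm.le hpb0),
          mul_le_mul_of_nonneg_left (wA (a + 1) (b + 1))
            (mul_nonneg hm.le (sub_nonneg.2 hpb1))]

end sums

/-- The number of compositions of `b` into `r` positive parts. -/
def compCount : ℕ → ℕ → ℕ
  | 0, 0 => 1
  | 0, _ + 1 => 0
  | _ + 1, 0 => 0
  | b + 1, r + 1 => b.choose r

theorem compCount_succ_succ (b r : ℕ) :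
    compCount (b + 1) (r + 1) = compCount b (r + 1) + compCount b r := by
  rcases b with _ | b <;> rcases r with _ | r <;>
    simp [compCount, Nat.choose_succ_succ, add_comm]

theorem compCount_eq_zero_of_lt {b r : ℕ} (h : b < r) : compCount b r = 0 := by
  rcases r with _ | r
  · omega
  · rcases b with _ | b
    · rfl
    · exact Nat.choose_eq_zero_of_lt (by omega)

/-- Sum of `c r`, where `r` is the number of blocks of B-points, over the arrangements of `a`
points of A and `b` points of B in which every block of B-points is followed by a point of A. -/
def blockSum (c : ℕ → ℝ) (a b : ℕ) : ℝ :=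
  ∑ r ∈ range (b + 1), (a.choose r : ℝ) * compCount b r * c r

theorem blockSum_eq_range {b n : ℕ} (hn : b + 1 ≤ n) (c : ℕ → ℝ) (a : ℕ) :
    blockSum c a b = ∑ r ∈ range n, (a.choose r : ℝ) * compCount b r * c r := by
  refine sum_subset (by simpa using hn) fun r _ hr => ?_
  rw [compCount_eq_zero_of_lt (by simpa using hr)]
  simp

theorem blockSum_succ_succ (c : ℕ → ℝ) (a b : ℕ) :
    blockSum c (a + 1) (b + 1) = blockSum c a (b + 1) + blockSum c (a + 1) b - blockSum c a b +
      blockSum (fun r => c (r + 1)) a b := by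
  rw [blockSum_eq_range (n := b + 2) le_rfl, blockSum_eq_range (n := b + 2) le_rfl,
    blockSum_eq_range (n := b + 2) (by omega), blockSum_eq_range (n := b + 2) (by omega),
    blockSum]
  simp only [sum_range_succ' _ (b + 1)]
  rw [← sub_eq_zero]
  have h : ∑ r ∈ range (b + 1),
      (((a + 1).choose (r + 1) : ℝ) * compCount (b + 1) (r + 1) * c (r + 1)
      - (a.choose (r + 1) : ℝ) * compCount (b + 1) (r + 1) * c (r + 1)
      - ((a + 1).choose (r + 1) : ℝ) * compCount b (r + 1) * c (r + 1)
      + (a.choose (r + 1) : ℝ) * compCount b (r + 1) * c (r + 1)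
      - (a.choose r : ℝ) * compCount b r * c (r + 1)) = 0 := by
    refine sum_eq_zero fun r _ => ?_
    rw [compCount_succ_succ, Nat.choose_succ_succ]
    push_cast
    ring
  simp only [sum_sub_distrib, sum_add_distrib] at h
  simp only [Nat.choose_zero_right]
  linear_combination h

theorem blockSum_zero_right (c : ℕ → ℝ) (a : ℕ) : blockSum c a 0 = c 0 := by
  simp [blockSum, compCount]

theorem blockSum_zero_succ (c : ℕ → ℝ) (b : ℕ) : blockSum c 0 (b + 1) = 0 := by
  simp [blockSum, sum_range_succ' _ (b + 1), compCount]

theorem blockSum_eq_sum_Icc (c : ℕ → ℝ) (a b : ℕ) :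
    blockSum c a b = ∑ r ∈ Icc (min b 1) (min a b),
      (a.choose r : ℝ) * ((b - 1).choose (r - 1) : ℝ) * c r := by
  rcases b with _ | b
  · simp [blockSum, compCount]
  · rw [blockSum]
    symm
    rw [← sum_subset (s₁ := Icc (min (b + 1) 1) (min a (b + 1))) (s₂ := range (b + 1 + 1))]
    · refine sum_congr rfl fun r hr => ?_
      rcases r with _ | r
      · simp at hr
      · simp [compCount]
    · intro r hr
      simp only [mem_Icc, mem_range] at hr ⊢
      omega
    · intro r hr hr'
      rcases r with _ | r
      · simp [compCount]
      · simp only [mem_Icc, mem_range] at hr hr'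
        rw [Nat.choose_eq_zero_of_lt (by omega)]
        simp

theorem blockSum_pow_pos {q : ℝ} (hq : 0 < q) (a b : ℕ) :
    0 < blockSum (fun r => q ^ r) (a + 1) b := by
  rcases b with _ | b
  · simp [blockSum_zero_right]
  · refine lt_of_lt_of_le ?_ (single_le_sum (fun r _ => by positivity)
      (show 1 ∈ range (b + 1 + 1) by simp))
    simp only [compCount, Nat.choose_one_right, Nat.choose_zero_right]
    positivity

section generating

variable {pa pb : ℝ}

theorem summable_soEndWeight (hpa0 : 0 ≤ pa) (hpa1 : pa ≤ 1) (hpb0 : 0 ≤ pb) (hpb1 : pb ≤ 1) :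
    (∀ a b, Summable (soEndWeight pa pb true a b)) ∧
      ∀ a b, Summable (soEndWeight pa pb false (a + 1) b) :=
  ⟨fun a b => summable_of_sum_boolListsLT_le (soEndWeight_nonneg hpa0 hpa1 hpb0 hpb1 _ _ _)
      fun n => (sum_soEndWeight_le hpa0 hpa1 hpb0 hpb1 n).1 a b,
    fun a b => summable_of_sum_boolListsLT_le (soEndWeight_nonneg hpa0 hpa1 hpb0 hpb1 _ _ _)
      fun n => (sum_soEndWeight_le hpa0 hpa1 hpb0 hpb1 n).2 a b⟩

theorem summable_soEndWeight_mul_length (hpa0 : 0 < pa) (hpa1 : pa ≤ 1) (hpb0 : 0 < pb)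
    (hpb1 : pb ≤ 1) :
    (∀ a b, Summable fun g => soEndWeight pa pb true a b g * g.length) ∧
      ∀ a b, Summable fun g => soEndWeight pa pb false (a + 1) b g * g.length := by
  have hm : 0 < min pa pb := lt_min hpa0 hpb0
  have h := sum_soEndWeight_mul_length_le hm (min_le_left _ _) hpa1 (min_le_right _ _) hpb1
  exact ⟨fun a b => summable_of_sum_boolListsLT_le
      (fun g => mul_nonneg (soEndWeight_nonneg hpa0.le hpa1 hpb0.le hpb1 _ _ _ g)
        g.length.cast_nonneg)
      fun n => (le_div_iff₀' hm).2 ((h n).1 a b),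
    fun a b => summable_of_sum_boolListsLT_le
      (fun g => mul_nonneg (soEndWeight_nonneg hpa0.le hpa1 hpb0.le hpb1 _ _ _ g)
        g.length.cast_nonneg)
      fun n => (le_div_iff₀' hm).2 ((h n).2 a b)⟩

theorem tsum_list_bool {f : List Bool → ℝ} (ht : Summable fun t => f (true :: t))
    (hf : Summable fun t => f (false :: t)) :
    ∑' g, f g = f [] + ∑' t, f (true :: t) + ∑' t, f (false :: t) :=
  (HasSum.list_bool ht.hasSum hf.hasSum).tsum_eq

/-- Total weight of the trajectories in `SoEnds`. -/
noncomputable def soMass (pa pb : ℝ) (srv : Bool) (a b : ℕ) : ℝ :=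
  ∑' g, soEndWeight pa pb srv a b g

/-- Total length-weighted weight of the trajectories in `SoEnds`. -/
noncomputable def soLengthMass (pa pb : ℝ) (srv : Bool) (a b : ℕ) : ℝ :=
  ∑' g, soEndWeight pa pb srv a b g * g.length

theorem soMass_true_zero (b : ℕ) : soMass pa pb true 0 b = if b = 0 then 1 else 0 := by
  simp only [soMass, soEndWeight_true_zero]
  by_cases hb : b = 0 <;> simp [hb]

theorem soLengthMass_true_zero (b : ℕ) : soLengthMass pa pb true 0 b = 0 := by
  simp only [soLengthMass, soEndWeight_true_zero]
  convert tsum_zero with g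
  split_ifs with h
  · simp [h.1]
  · simp

/-- Multiplying by the length after prepending one rally of probability `p`. -/
theorem tsum_mul_length_cons {f : List Bool → ℝ} (p : ℝ) (s : Bool) (hf : Summable f)
    (hl : Summable fun g => f g * g.length) :
    (Summable fun t : List Bool => p * f t * ((s :: t).length : ℝ)) ∧
      ∑' t : List Bool, p * f t * ((s :: t).length : ℝ) =
        p * (∑' t, f t * t.length + ∑' t, f t) := by
  have h : (fun t : List Bool => p * f t * ((s :: t).length : ℝ)) =
      fun t => p * (f t * t.length + f t) := by
    funext t
    push_cast [List.length_cons]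
    ring
  rw [h, tsum_mul_left, hl.tsum_add hf]
  exact ⟨(hl.add hf).mul_left p, rfl⟩

theorem soMass_true_succ (hpa0 : 0 < pa) (hpa1 : pa < 1) (hpb0 : 0 < pb) (hpb1 : pb < 1)
    (a b : ℕ) :
    soMass pa pb true (a + 1) b =
      pa * soMass pa pb true a b + (1 - pa) * soMass pa pb false (a + 1) b := by
  obtain ⟨hA, hB⟩ := summable_soEndWeight hpa0.le hpa1.le hpb0.le hpb1.le
  rw [soMass, tsum_list_bool]
  · simp only [soEndWeight_true_cons, soEndWeight_true_cons_false, soEndWeight_succ_nil,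
      tsum_mul_left, soMass, zero_add]
  · simpa only [soEndWeight_true_cons] using (hA a b).mul_left pa
  · simpa only [soEndWeight_true_cons_false] using (hB a b).mul_left (1 - pa)

theorem soMass_false_zero (hpa0 : 0 < pa) (hpa1 : pa < 1) (hpb0 : 0 < pb) (hpb1 : pb < 1)
    (a : ℕ) :
    soMass pa pb false (a + 1) 0 = (1 - pb) * soMass pa pb true (a + 1) 0 := by
  obtain ⟨hA, hB⟩ := summable_soEndWeight hpa0.le hpa1.le hpb0.le hpb1.le
  rw [soMass, tsum_list_bool]
  · simp only [soEndWeight_false_zero_cons, soEndWeight_false_cons_false, soEndWeight_succ_nil,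
      tsum_mul_left, soMass, zero_add, tsum_zero]
  · simpa only [soEndWeight_false_zero_cons] using summable_zero
  · simpa only [soEndWeight_false_cons_false] using (hA (a + 1) 0).mul_left (1 - pb)

theorem soMass_false_succ (hpa0 : 0 < pa) (hpa1 : pa < 1) (hpb0 : 0 < pb) (hpb1 : pb < 1)
    (a b : ℕ) :
    soMass pa pb false (a + 1) (b + 1) =
      pb * soMass pa pb false (a + 1) b + (1 - pb) * soMass pa pb true (a + 1) (b + 1) := by
  obtain ⟨hA, hB⟩ := summable_soEndWeight hpa0.le hpa1.le hpb0.le hpb1.le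
  rw [soMass, tsum_list_bool]
  · simp only [soEndWeight_false_cons, soEndWeight_false_cons_false, soEndWeight_succ_nil,
      tsum_mul_left, soMass, zero_add]
  · simpa only [soEndWeight_false_cons] using (hB a b).mul_left pb
  · simpa only [soEndWeight_false_cons_false] using (hA (a + 1) (b + 1)).mul_left (1 - pb)

theorem soLengthMass_true_succ (hpa0 : 0 < pa) (hpa1 : pa < 1) (hpb0 : 0 < pb) (hpb1 : pb < 1)
    (a b : ℕ) :
    soLengthMass pa pb true (a + 1) b =
      pa * (soLengthMass pa pb true a b + soMass pa pb true a b) +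
        (1 - pa) * (soLengthMass pa pb false (a + 1) b + soMass pa pb false (a + 1) b) := by
  obtain ⟨hA, hB⟩ := summable_soEndWeight hpa0.le hpa1.le hpb0.le hpb1.le
  obtain ⟨lA, lB⟩ := summable_soEndWeight_mul_length hpa0 hpa1.le hpb0 hpb1.le
  obtain ⟨s1, e1⟩ := tsum_mul_length_cons pa true (hA a b) (lA a b)
  obtain ⟨s2, e2⟩ := tsum_mul_length_cons (1 - pa) false (hB a b) (lB a b)
  rw [soLengthMass, tsum_list_bool]
  · simp only [soEndWeight_true_cons, soEndWeight_true_cons_false, soEndWeight_succ_nil,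
      e1, e2, soMass, soLengthMass, zero_mul, zero_add]
  · simpa only [soEndWeight_true_cons] using s1
  · simpa only [soEndWeight_true_cons_false] using s2

theorem soLengthMass_false_zero (hpa0 : 0 < pa) (hpa1 : pa < 1) (hpb0 : 0 < pb) (hpb1 : pb < 1)
    (a : ℕ) :
    soLengthMass pa pb false (a + 1) 0 =
      (1 - pb) * (soLengthMass pa pb true (a + 1) 0 + soMass pa pb true (a + 1) 0) := by
  obtain ⟨hA, hB⟩ := summable_soEndWeight hpa0.le hpa1.le hpb0.le hpb1.le
  obtain ⟨lA, lB⟩ := summable_soEndWeight_mul_length hpa0 hpa1.le hpb0 hpb1.le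
  obtain ⟨s2, e2⟩ := tsum_mul_length_cons (1 - pb) false (hA (a + 1) 0) (lA (a + 1) 0)
  rw [soLengthMass, tsum_list_bool]
  · simp only [soEndWeight_false_zero_cons, soEndWeight_false_cons_false, soEndWeight_succ_nil,
      e2, soMass, soLengthMass, zero_mul, zero_add, tsum_zero]
  · simpa only [soEndWeight_false_zero_cons, zero_mul] using summable_zero
  · simpa only [soEndWeight_false_cons_false] using s2

theorem soLengthMass_false_succ (hpa0 : 0 < pa) (hpa1 : pa < 1) (hpb0 : 0 < pb) (hpb1 : pb < 1)
    (a b : ℕ) :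
    soLengthMass pa pb false (a + 1) (b + 1) =
      pb * (soLengthMass pa pb false (a + 1) b + soMass pa pb false (a + 1) b) +
        (1 - pb) * (soLengthMass pa pb true (a + 1) (b + 1) +
          soMass pa pb true (a + 1) (b + 1)) := by
  obtain ⟨hA, hB⟩ := summable_soEndWeight hpa0.le hpa1.le hpb0.le hpb1.le
  obtain ⟨lA, lB⟩ := summable_soEndWeight_mul_length hpa0 hpa1.le hpb0 hpb1.le
  obtain ⟨s1, e1⟩ := tsum_mul_length_cons pb true (hB a b) (lB a b)
  obtain ⟨s2, e2⟩ := tsum_mul_length_cons (1 - pb) false (hA (a + 1) (b + 1))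
    (lA (a + 1) (b + 1))
  rw [soLengthMass, tsum_list_bool]
  · simp only [soEndWeight_false_cons, soEndWeight_false_cons_false, soEndWeight_succ_nil,
      e1, e2, soMass, soLengthMass, zero_mul, zero_add]
  · simpa only [soEndWeight_false_cons] using s1
  · simpa only [soEndWeight_false_cons_false] using s2

theorem soMass_soLengthMass_eq (hpa0 : 0 < pa) (hpa1 : pa < 1) (hpb0 : 0 < pb) (hpb1 : pb < 1)
    {q : ℝ} (hq : q = (1 - pa) * (1 - pb)) (a b : ℕ) :
    soMass pa pb true a b =
        pa ^ a * pb ^ b / (1 - q) ^ (a + b) * blockSum (fun r => q ^ r) a b ∧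
      soLengthMass pa pb true a b =
        pa ^ a * pb ^ b / (1 - q) ^ (a + b) *
          ((a + b) * (1 + q) / (1 - q) * blockSum (fun r => q ^ r) a b +
            2 * blockSum (fun r => r * q ^ r) a b) := by
  have hd : 1 - q ≠ 0 := by rw [hq]; nlinarith [mul_pos hpa0 hpb0]
  have hS : ∀ a b, blockSum (fun r => q ^ (r + 1)) a b = q * blockSum (fun r => q ^ r) a b := by
    intro a b
    simp only [blockSum, mul_sum]
    exact sum_congr rfl fun r _ => by ring
  have hM : ∀ a b, blockSum (fun r => ((r + 1 : ℕ) : ℝ) * q ^ (r + 1)) a b =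
      q * blockSum (fun r => r * q ^ r) a b + q * blockSum (fun r => q ^ r) a b := by
    intro a b
    simp only [blockSum, mul_sum, ← sum_add_distrib]
    exact sum_congr rfl fun r _ => by push_cast; ring
  induction a generalizing b with
  | zero =>
    rcases b with _ | b
    · simp [soMass_true_zero, soLengthMass_true_zero, blockSum_zero_right]
    · simp [soMass_true_zero, soLengthMass_true_zero, blockSum_zero_succ]
  | succ a iha =>
    induction b with
    | zero =>
      obtain ⟨w, l⟩ := iha 0
      have w1 := soMass_true_succ hpa0 hpa1 hpb0 hpb1 a 0
      have w2 := soMass_false_zero hpa0 hpa1 hpb0 hpb1 a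
      have l1 := soLengthMass_true_succ hpa0 hpa1 hpb0 hpb1 a 0
      have l2 := soLengthMass_false_zero hpa0 hpa1 hpb0 hpb1 a
      simp only [blockSum_zero_right] at w l ⊢
      have hW : (1 - q) * soMass pa pb true (a + 1) 0 = pa * soMass pa pb true a 0 := by
        linear_combination w1 + (1 - pa) * w2 - soMass pa pb true (a + 1) 0 * hq
      have hL : (1 - q) * soLengthMass pa pb true (a + 1) 0 =
          pa * soLengthMass pa pb true a 0 + (1 + q) * soMass pa pb true (a + 1) 0 := by
        linear_combination l1 + (1 - pa) * l2 - w1 -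
          (soLengthMass pa pb true (a + 1) 0 + soMass pa pb true (a + 1) 0) * hq
      have hW' : soMass pa pb true (a + 1) 0 =
          pa ^ (a + 1) * pb ^ 0 / (1 - q) ^ (a + 1 + 0) * q ^ 0 := by
        apply mul_left_cancel₀ hd
        rw [hW, w]
        field_simp
        ring
      refine ⟨hW', mul_left_cancel₀ hd ?_⟩
      rw [hL, hW', l]
      push_cast
      field_simp
      ring
    | succ b ihb =>
      obtain ⟨wa, la⟩ := iha (b + 1)
      obtain ⟨w0, l0⟩ := iha b
      obtain ⟨wb, lb⟩ := ihb
      have w1 := soMass_true_succ hpa0 hpa1 hpb0 hpb1 a (b + 1)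
      have w2 := soMass_false_succ hpa0 hpa1 hpb0 hpb1 a b
      have w3 := soMass_true_succ hpa0 hpa1 hpb0 hpb1 a b
      have l1 := soLengthMass_true_succ hpa0 hpa1 hpb0 hpb1 a (b + 1)
      have l2 := soLengthMass_false_succ hpa0 hpa1 hpb0 hpb1 a b
      have l3 := soLengthMass_true_succ hpa0 hpa1 hpb0 hpb1 a b
      have hW : (1 - q) * soMass pa pb true (a + 1) (b + 1) =
          pa * soMass pa pb true a (b + 1) + pb * soMass pa pb true (a + 1) b -
            pa * pb * soMass pa pb true a b := by
        linear_combination w1 + (1 - pa) * w2 - pb * w3 -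
          soMass pa pb true (a + 1) (b + 1) * hq
      have hL : (1 - q) * soLengthMass pa pb true (a + 1) (b + 1) =
          pa * soLengthMass pa pb true a (b + 1) + pb * soLengthMass pa pb true (a + 1) b -
            pa * pb * (soLengthMass pa pb true a b + soMass pa pb true a b) +
            (1 + q) * soMass pa pb true (a + 1) (b + 1) := by
        linear_combination l1 + (1 - pa) * l2 - pb * l3 - w1 -
          (soLengthMass pa pb true (a + 1) (b + 1) + soMass pa pb true (a + 1) (b + 1)) * hq
      have hW' : soMass pa pb true (a + 1) (b + 1) =
          pa ^ (a + 1) * pb ^ (b + 1) / (1 - q) ^ (a + 1 + (b + 1)) *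
            blockSum (fun r => q ^ r) (a + 1) (b + 1) := by
        apply mul_left_cancel₀ hd
        rw [hW, wa, wb, w0, blockSum_succ_succ, hS]
        field_simp
        ring
      refine ⟨hW', mul_left_cancel₀ hd ?_⟩
      rw [hL, hW', la, lb, l0, w0, blockSum_succ_succ, blockSum_succ_succ, hS, hM]
      push_cast
      field_simp
      ring

end generating

end

theorem stmt_6 (α β : ℕ) (hα : 1 ≤ α) (pa pb : ℝ) (hpa0 : 0 < pa) (hpa1 : pa < 1)
    (hpb0 : 0 < pb) (hpb1 : pb < 1) :
    soCondExp pa pb {g : List Bool | soScoreA g = α ∧ soScoreB g = β ∧ soLastA g}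
        (fun g => (g.length : ℝ)) =
      ((α : ℝ) + β) * (1 + (1 - pa) * (1 - pb)) / (1 - (1 - pa) * (1 - pb)) +
        2 * (∑ r ∈ Finset.Icc (min β 1) (min α β),
              (r : ℝ) * ((α.choose r : ℝ) * ((β - 1).choose (r - 1) : ℝ) *
                ((1 - pa) * (1 - pb)) ^ r)) /
          (∑ r ∈ Finset.Icc (min β 1) (min α β),
            (α.choose r : ℝ) * ((β - 1).choose (r - 1) : ℝ) * ((1 - pa) * (1 - pb)) ^ r) := by
  obtain ⟨a, rfl⟩ : ∃ a, α = a + 1 := ⟨α - 1, by omega⟩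
  have hE : {g : List Bool | soScoreA g = a + 1 ∧ soScoreB g = β ∧ soLastA g} =
      {g | SoEnds true (a + 1) β g} :=
    Set.ext fun g => (soEnds_true_iff a β g).symm
  have hP : soPr pa pb {g | SoEnds true (a + 1) β g} = soMass pa pb true (a + 1) β := by
    refine tsum_congr fun g => ?_
    by_cases h : SoEnds true (a + 1) β g <;> simp [soEndWeight, h]
  have hLen : ∑' g : List Bool, Set.indicator {g | SoEnds true (a + 1) β g}
      (fun g => soWeight pa pb true g * (g.length : ℝ)) g =
        soLengthMass pa pb true (a + 1) β := by
    refine tsum_congr fun g => ?_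
    by_cases h : SoEnds true (a + 1) β g <;> simp [soEndWeight, h]
  obtain ⟨hM, hL⟩ := soMass_soLengthMass_eq hpa0 hpa1 hpb0 hpb1 rfl (a + 1) β
  have hq : 0 < (1 - pa) * (1 - pb) := mul_pos (by linarith) (by linarith)
  have hq1 : 0 < 1 - (1 - pa) * (1 - pb) := by nlinarith [mul_pos hpa0 hpb0]
  have hN := blockSum_pow_pos hq a β
  have hR : ∑ r ∈ Finset.Icc (min β 1) (min (a + 1) β),
      (r : ℝ) * (((a + 1).choose r : ℝ) * ((β - 1).choose (r - 1) : ℝ) *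
        ((1 - pa) * (1 - pb)) ^ r) =
      blockSum (fun r => r * ((1 - pa) * (1 - pb)) ^ r) (a + 1) β := by
    rw [blockSum_eq_sum_Icc]
    exact Finset.sum_congr rfl fun r _ => by ring
  rw [soCondExp, hE, hP, hLen, hR, ← blockSum_eq_sum_Icc (fun r => ((1 - pa) * (1 - pb)) ^ r),
    hM, hL]
  generalize (1 - pa) * (1 - pb) = q at *
  rw [mul_div_mul_left _ _ (by positivity)]
  field_simp
end

section
/- Conditional on an A-served side-out game ending at score (α,β) with A scoring last, the variance of the number of rallies equals 4(α+β)·q/(1-q)^2 + 4·Var[R], where R is the number of A-interruptions with distribution P[R=r] ∝ C(α,r) C(β-1,r-1) q^r, r ∈ {min(β,1),…,min(α,β)}, and q = (1-p_a)(1-p_b). -/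
open scoped BigOperators
open Filter

/-- Trajectories in which the first server scores `x`, the receiver scores `y`, with `k` side-outs. -/
def trajSet (srv : Bool) (x y k : ℕ) : Set (List Bool) :=
  {g | (soScorers srv g).count srv = x ∧ (soScorers srv g).count (!srv) = y ∧ g.count false = k}

theorem encard_image_cons (b : Bool) (s : Set (List Bool)) :
    (List.cons b '' s).encard = s.encard :=
  (List.cons_injective (a := b)).encard_image s

theorem trajSet_zero_zero (srv : Bool) (y : ℕ) :
    trajSet srv 0 y 0 = if y = 0 then {[]} else ∅ := by
  ext g
  rcases g with _ | ⟨_ | _, g⟩ <;> cases srv <;> by_cases hy : y = 0 <;>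
    simp [trajSet, soScorers, hy, eq_comm]

theorem trajSet_succ_zero (srv : Bool) (x y : ℕ) :
    trajSet srv (x + 1) y 0 = List.cons true '' trajSet srv x y 0 := by
  ext g
  rcases g with _ | ⟨_ | _, g⟩ <;> cases srv <;> simp [trajSet, soScorers]

theorem trajSet_zero_succ (srv : Bool) (y k : ℕ) :
    trajSet srv 0 y (k + 1) = List.cons false '' trajSet (!srv) y 0 k := by
  ext g
  rcases g with _ | ⟨_ | _, g⟩ <;> cases srv <;> simp [trajSet, soScorers] <;> tauto

theorem trajSet_succ_succ (srv : Bool) (x y k : ℕ) :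
    trajSet srv (x + 1) y (k + 1) =
      List.cons true '' trajSet srv x y (k + 1) ∪
        List.cons false '' trajSet (!srv) y (x + 1) k := by
  ext g
  rcases g with _ | ⟨_ | _, g⟩ <;> cases srv <;> simp [trajSet, soScorers] <;> tauto

theorem encard_trajSet (k x y : ℕ) (srv : Bool) :
    (trajSet srv x y k).encard =
      ((Nat.multichoose (k / 2 + 1) x * Nat.multichoose ((k + 1) / 2) y : ℕ) : ℕ∞) := by
  induction k generalizing srv x y with
  | zero =>
    induction x with
    | zero =>
      rw [trajSet_zero_zero]
      cases y <;> simp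
    | succ x ih =>
      rw [trajSet_succ_zero, encard_image_cons, ih]
      simp
  | succ k ihk =>
    have h2 : (k + 1 + 1) / 2 = k / 2 + 1 := by omega
    induction x with
    | zero =>
      rw [trajSet_zero_succ, encard_image_cons, ihk, h2]
      simp
    | succ x ih =>
      rw [trajSet_succ_succ, Set.encard_union_eq, encard_image_cons, encard_image_cons, ih, ihk,
        h2, Nat.multichoose_succ_succ ((k + 1) / 2)]
      · norm_cast
        ring
      · rw [Set.disjoint_left]
        rintro _ ⟨g, -, rfl⟩ ⟨g', -, h⟩
        simp at h

theorem soScorers_append_true (srv : Bool) (g : List Bool) :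
    soScorers srv (g ++ [true]) =
      soScorers srv g ++ [srv ^^ decide (g.count false % 2 = 1)] := by
  induction g generalizing srv with
  | nil => cases srv <;> simp [soScorers]
  | cons s g ih =>
    rcases Nat.mod_two_eq_zero_or_one (g.count false) with h | h <;>
    cases s <;> cases srv <;> simp [soScorers, ih, h, Nat.add_mod]

theorem soWeight_eq (pa pb : ℝ) (g : List Bool) :
    soWeight pa pb true g = pa ^ (soScorers true g).count true *
        pb ^ (soScorers true g).count false *
        ((1 - pa) ^ ((g.count false + 1) / 2) * (1 - pb) ^ (g.count false / 2)) ∧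
    soWeight pa pb false g = pa ^ (soScorers false g).count true *
        pb ^ (soScorers false g).count false *
        ((1 - pa) ^ (g.count false / 2) * (1 - pb) ^ ((g.count false + 1) / 2)) := by
  induction g with
  | nil => simp [soWeight, soScorers]
  | cons s g ih =>
    have h2 : (g.count false + 1 + 1) / 2 = g.count false / 2 + 1 := by omega
    cases s <;> simp [soWeight, soScorers, ih, h2, pow_succ] <;> constructor <;> ring

theorem length_eq (srv : Bool) (g : List Bool) :
    g.length = (soScorers srv g).count true + (soScorers srv g).count false +
      g.count false := by
  induction g generalizing srv with
  | nil => simp [soScorers]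
  | cons s g ih =>
    cases s
    · simp [soScorers, ih (!srv)]; omega
    · rw [List.length_cons, ih srv]
      cases srv <;> simp [soScorers, -List.count_true_add_count_false] <;> omega

/-- Summing a function of the value of `k` over a set whose `k`-fibres have known size. -/
theorem hasSum_indicator_of_encard_fiber {ι : Type*} (E : Set ι) (k : ι → ℕ) (c : ℕ → ℕ)
    (F : ι → ℝ) (H : ℕ → ℝ) (hH : ∀ m, 0 ≤ H m) (hF : ∀ g ∈ E, F g = H (k g))
    (hc : ∀ m, {g | g ∈ E ∧ k g = m}.encard = c m) {S : ℝ}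
    (hS : HasSum (fun m => (c m : ℝ) * H m) S) : HasSum (E.indicator F) S := by
  rw [← hasSum_subtype_iff_indicator]
  rw [← (Equiv.sigmaFiberEquiv (fun g : E => k g)).hasSum_iff]
  have hfib : ∀ m, HasSum (fun x : {g : E // k g = m} =>
      (F ∘ (↑) ∘ (Equiv.sigmaFiberEquiv (fun g : E => k g))) ⟨m, x⟩) ((c m : ℝ) * H m) := by
    intro m
    have hcard : ENat.card {g : E // k g = m} = c m := by
      rw [← hc m, Set.encard]
      exact ENat.card_congr (Equiv.subtypeSubtypeEquivSubtypeInter (· ∈ E) (fun g => k g = m))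
    have : Finite {g : E // k g = m} := by
      rw [← ENat.card_lt_top, hcard]; simp
    have := Fintype.ofFinite {g : E // k g = m}
    have hcard' : Fintype.card {g : E // k g = m} = c m := by
      rw [ENat.card_eq_coe_fintype_card] at hcard; exact_mod_cast hcard
    convert hasSum_fintype (fun x : {g : E // k g = m} => H m) using 1
    · ext x
      simp [Equiv.sigmaFiberEquiv, hF _ x.1.2, x.2]
    · simp [hcard']
  refine HasSum.sigma_of_hasSum hS hfib ?_
  rw [summable_sigma_of_nonneg]
  · refine ⟨fun m => (hfib m).summable, ?_⟩
    convert hS.summable using 2 with m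
    exact (hfib m).tsum_eq
  · rintro ⟨m, x⟩
    simp [Equiv.sigmaFiberEquiv, hF _ x.1.2, hH]

open PowerSeries in
theorem one_sub_X_pow_mul_mk_multichoose (a : ℕ) :
    (1 - X : ℝ⟦X⟧) ^ (a + 1) * mk (fun m => ((m + 1).multichoose a : ℝ)) = 1 := by
  have h := (invOneSubPow ℝ (a + 1)).inv_val
  rw [invOneSubPow_inv_eq_one_sub_pow,
    invOneSubPow_val_eq_mk_sub_one_add_choose_of_pos _ _ a.succ_pos] at h
  convert h using 3
  ext m
  rw [Nat.multichoose_eq, show m + 1 + a - 1 = a + 1 - 1 + m by omega, Nat.add_sub_cancel]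

open PowerSeries in
theorem one_sub_X_pow_mul_mk_multichoose_mul (b : ℕ) : ∀ a : ℕ,
    (1 - X : ℝ⟦X⟧) ^ (a + b + 1) *
        mk (fun m => ((m + 1).multichoose a * (m + 1).multichoose b : ℝ)) =
      mk (fun r => (a.choose r * b.choose r : ℝ)) ∧
    (1 - X : ℝ⟦X⟧) ^ (a + b + 2) *
        mk (fun m => ((m + 1).multichoose a * m.multichoose (b + 1) : ℝ)) =
      X * mk (fun s => ((a + 1).choose (s + 1) * b.choose s : ℝ)) := by
  have key : ∀ b : ℕ,
      (∀ a : ℕ, (1 - X : ℝ⟦X⟧) ^ (a + b + 1) *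
        mk (fun m => ((m + 1).multichoose a * (m + 1).multichoose b : ℝ)) =
        mk (fun r => (a.choose r * b.choose r : ℝ))) →
      ∀ a : ℕ, (1 - X : ℝ⟦X⟧) ^ (a + b + 2) *
        mk (fun m => ((m + 1).multichoose a * m.multichoose (b + 1) : ℝ)) =
        X * mk (fun s => ((a + 1).choose (s + 1) * b.choose s : ℝ)) := by
    intro b hB a
    induction a with
    | zero =>
      have h : (1 - X : ℝ⟦X⟧) *
          mk (fun m => ((m + 1).multichoose 0 * m.multichoose (b + 1) : ℝ)) =
          X * mk (fun m => ((m + 1).multichoose 0 * (m + 1).multichoose b : ℝ)) := by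
        rw [sub_mul, one_mul, sub_eq_iff_eq_add, ← mul_add]
        ext m
        cases m with
        | zero => simp
        | succ m =>
          simp [coeff_succ_X_mul, Nat.multichoose_succ_succ]
          ring
      have h' : (mk (fun s => ((0 + 1).choose (s + 1) * b.choose s : ℝ)) : ℝ⟦X⟧) =
          mk (fun r => (Nat.choose 0 r * b.choose r : ℝ)) := by
        ext s
        simp [Nat.choose_succ_succ 0 s]
      rw [h', ← hB 0, pow_succ, mul_assoc, h]
      ring
    | succ a ih =>
      have h : (1 - X : ℝ⟦X⟧) *
          mk (fun m => ((m + 1).multichoose (a + 1) * m.multichoose (b + 1) : ℝ)) =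
          mk (fun m => ((m + 1).multichoose a * m.multichoose (b + 1) : ℝ)) +
          X * mk (fun m => ((m + 1).multichoose (a + 1) * (m + 1).multichoose b : ℝ)) := by
        rw [sub_mul, one_mul, sub_eq_iff_eq_add, add_assoc, ← mul_add]
        ext m
        cases m with
        | zero => simp
        | succ m =>
          simp [coeff_succ_X_mul, Nat.multichoose_succ_succ]
          ring
      have h' : (mk (fun s => ((a + 1 + 1).choose (s + 1) * b.choose s : ℝ)) : ℝ⟦X⟧) =
          mk (fun s => ((a + 1).choose (s + 1) * b.choose s : ℝ)) +
          mk (fun r => ((a + 1).choose r * b.choose r : ℝ)) := by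
        ext s
        simp [Nat.choose_succ_succ (a + 1) s]
        ring
      rw [h', mul_add, ← ih, ← hB (a + 1), pow_succ, mul_assoc, h]
      ring
  have hB : ∀ b a : ℕ, (1 - X : ℝ⟦X⟧) ^ (a + b + 1) *
      mk (fun m => ((m + 1).multichoose a * (m + 1).multichoose b : ℝ)) =
      mk (fun r => (a.choose r * b.choose r : ℝ)) := by
    intro b
    induction b with
    | zero =>
      intro a
      have h := one_sub_X_pow_mul_mk_multichoose a
      simp only [Nat.multichoose_zero_right, Nat.cast_one, mul_one, add_zero]
      rw [h]
      ext m
      cases m <;> simp [coeff_one]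
    | succ b ih =>
      intro a
      have h : (mk (fun m => ((m + 1).multichoose a * (m + 1).multichoose (b + 1) : ℝ)) : ℝ⟦X⟧) =
          mk (fun m => ((m + 1).multichoose a * (m + 1).multichoose b : ℝ)) +
          mk (fun m => ((m + 1).multichoose a * m.multichoose (b + 1) : ℝ)) := by
        ext m
        simp [Nat.multichoose_succ_succ]
        ring
      rw [h, mul_add, show a + (b + 1) + 1 = a + b + 2 by ring, key b ih a,
        show a + b + 2 = (a + b + 1) + 1 by ring, pow_succ, mul_comm _ (1 - X), mul_assoc, ih a]
      rw [sub_mul, one_mul, sub_add_eq_add_sub, sub_eq_iff_eq_add]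
      ext m
      cases m with
      | zero => simp
      | succ m =>
        simp [coeff_succ_X_mul, Nat.choose_succ_succ]
        ring
  exact fun a => ⟨hB b a, key b (hB b) a⟩

open PowerSeries in
theorem one_sub_X_pow_mul_mk_eq_sum (a b : ℕ) :
    (1 - X : ℝ⟦X⟧) ^ (a + 1 + b) *
        mk (fun m => ((m + 1).multichoose a * m.multichoose b : ℝ)) =
      ∑ r ∈ Finset.Icc (min b 1) (min (a + 1) b),
        ((a + 1).choose r * (b - 1).choose (r - 1) : ℝ) • (X : ℝ⟦X⟧) ^ r := by
  cases b with
  | zero => simpa using one_sub_X_pow_mul_mk_multichoose a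
  | succ b =>
    rw [show a + 1 + (b + 1) = a + b + 2 by ring, (one_sub_X_pow_mul_mk_multichoose_mul b a).2]
    ext m
    simp only [map_sum, map_smul, coeff_X_pow, smul_eq_mul, mul_ite, mul_one, mul_zero,
      Finset.sum_ite_eq, Finset.mem_Icc]
    cases m with
    | zero => simp
    | succ m =>
      rw [coeff_succ_X_mul, coeff_mk]
      split_ifs with h
      · simp
      · have : a < m ∨ b < m := by
          by_contra! hc
          apply h
          constructor
          · simp
          · simp [hc]
        rcases this with h | h
        · simp [Nat.choose_eq_zero_of_lt (show a + 1 < m + 1 by omega)]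
        · simp [Nat.choose_eq_zero_of_lt h]

open PowerSeries in
theorem multichoose_mul_multichoose_eq_sum (a b m : ℕ) :
    ((m + 1).multichoose a * m.multichoose b : ℝ) =
      ∑ r ∈ Finset.Icc (min b 1) (min (a + 1) b),
        ((a + 1).choose r * (b - 1).choose (r - 1) : ℝ) *
          (if r ≤ m then ((m - r + (a + b)).choose (a + b) : ℝ) else 0) := by
  have h := congrArg (fun f => (invOneSubPow ℝ (a + 1 + b)).val * f)
    (one_sub_X_pow_mul_mk_eq_sum a b)
  rw [← mul_assoc, ← invOneSubPow_inv_eq_one_sub_pow, (invOneSubPow ℝ (a + 1 + b)).val_inv,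
    one_mul, invOneSubPow_val_eq_mk_sub_one_add_choose_of_pos _ _ (by omega)] at h
  have h := congrArg (coeff m) h
  rw [coeff_mk, Finset.mul_sum, map_sum] at h
  rw [h]
  refine Finset.sum_congr rfl fun r _ => ?_
  rw [mul_smul_comm, map_smul, mul_comm _ (X ^ r), coeff_X_pow_mul', smul_eq_mul]
  simp only [coeff_mk]
  rw [show a + 1 + b - 1 = a + b by omega, add_comm (a + b)]

theorem hasSum_real_of_eq {f g : ℕ → ℝ} {a b : ℝ} (h : HasSum f a) (hf : ∀ n, g n = f n)
    (ha : b = a) : HasSum g b := by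
  rw [funext hf, ha]
  exact h

theorem hasSum_choose_mul_geometric (d : ℕ) {q : ℝ} (hq : ‖q‖ < 1) :
    HasSum (fun j : ℕ => ((j + d).choose d : ℝ) * q ^ j) (1 / (1 - q) ^ (d + 1)) :=
  hasSum_choose_mul_geometric_of_norm_lt_one d hq

theorem hasSum_mul_choose_mul_geometric (d : ℕ) {q : ℝ} (hq : ‖q‖ < 1) :
    HasSum (fun j : ℕ => (j : ℝ) * (((j + d).choose d : ℝ) * q ^ j))
      ((d + 1) * q / (1 - q) ^ (d + 2)) := by
  have h := (hasSum_choose_mul_geometric (d + 1) hq).mul_left ((d + 1) * q)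
  rw [← hasSum_nat_add_iff' 1]
  refine hasSum_real_of_eq h (fun j => ?_) ?_
  · have h2 := Nat.choose_succ_right_eq (j + 1 + d) d
    rw [show j + 1 + d - d = j + 1 by omega, show j + 1 + d = j + (d + 1) by ring] at h2
    have h3 : ((j + (d + 1)).choose (d + 1) : ℝ) * (d + 1) =
      (j + (d + 1)).choose d * (j + 1) := by exact_mod_cast h2
    rw [show j + 1 + d = j + (d + 1) by ring, pow_succ]
    push_cast
    linear_combination (-q ^ j * q) * h3
  · simp [div_eq_mul_inv]

theorem hasSum_sq_mul_choose_mul_geometric (d : ℕ) {q : ℝ} (hq : ‖q‖ < 1) :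
    HasSum (fun j : ℕ => (j : ℝ) ^ 2 * (((j + d).choose d : ℝ) * q ^ j))
      ((d + 1) * q * (1 / (1 - q) ^ (d + 2) + (d + 2) * q / (1 - q) ^ (d + 3))) := by
  have h := ((hasSum_choose_mul_geometric (d + 1) hq).add
    (hasSum_mul_choose_mul_geometric (d + 1) hq)).mul_left ((d + 1) * q)
  rw [← hasSum_nat_add_iff' 1]
  refine hasSum_real_of_eq h (fun j => ?_) ?_
  · have h2 := Nat.choose_succ_right_eq (j + 1 + d) d
    rw [show j + 1 + d - d = j + 1 by omega, show j + 1 + d = j + (d + 1) by ring] at h2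
    have h3 : ((j + (d + 1)).choose (d + 1) : ℝ) * (d + 1) =
      (j + (d + 1)).choose d * (j + 1) := by exact_mod_cast h2
    rw [show j + 1 + d = j + (d + 1) by ring, pow_succ]
    push_cast
    linear_combination (-(j + 1) * q ^ j * q) * h3
  · rw [Finset.sum_range_one]
    push_cast
    ring

theorem hasSum_quadratic_mul_choose_mul_geometric (d : ℕ) {q : ℝ} (hq : ‖q‖ < 1)
    (u v w : ℝ) :
    HasSum (fun j : ℕ => ((j + d).choose d : ℝ) * q ^ j * (u + v * j + w * (j : ℝ) ^ 2))
      (1 / (1 - q) ^ (d + 1) * (u + v * ((d + 1) * (q / (1 - q))) +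
        w * ((d + 1) * (q / (1 - q)) + (d + 1) * (d + 2) * (q / (1 - q)) ^ 2))) := by
  have hq1 : 1 - q ≠ 0 := by
    rintro h
    rw [← sub_eq_zero.1 h] at hq
    simp at hq
  have h := (((hasSum_choose_mul_geometric d hq).mul_left u).add
    ((hasSum_mul_choose_mul_geometric d hq).mul_left v)).add
    ((hasSum_sq_mul_choose_mul_geometric d hq).mul_left w)
  refine hasSum_real_of_eq h (fun j => ?_) ?_
  · ring
  · field_simp
    ring

/-- Moments of `m = r + j` when `j` is negative binomial with `α + β` successes and `r` is an
independent number of interruptions, in terms of the unnormalised weights. -/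
theorem hasSum_multichoose_mul_quadratic (a b : ℕ) {q : ℝ} (hq : ‖q‖ < 1) (u v w : ℝ) :
    HasSum (fun m : ℕ => ((m + 1).multichoose a * m.multichoose b : ℝ) *
        (q ^ m * (u + v * m + w * (m : ℝ) ^ 2)))
      (∑ r ∈ Finset.Icc (min b 1) (min (a + 1) b),
        ((a + 1).choose r * (b - 1).choose (r - 1) : ℝ) * q ^ r *
        (1 / (1 - q) ^ (a + b + 1) * ((u + v * r + w * (r : ℝ) ^ 2) +
          (v + 2 * w * r) * ((a + b + 1) * (q / (1 - q))) +
          w * ((a + b + 1) * (q / (1 - q)) + (a + b + 1) * (a + b + 2) * (q / (1 - q)) ^ 2)))) := by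
  simp_rw [multichoose_mul_multichoose_eq_sum, Finset.sum_mul]
  refine hasSum_sum fun r _ => ?_
  simp_rw [mul_assoc _ (ite _ _ _), mul_assoc _ (q ^ r)]
  refine HasSum.mul_left _ ?_
  rw [← (add_left_injective r).hasSum_iff]
  · have h := (hasSum_quadratic_mul_choose_mul_geometric (a + b) hq
      (u + v * r + w * (r : ℝ) ^ 2) (v + 2 * w * r) w).mul_left (q ^ r)
    push_cast at h
    refine hasSum_real_of_eq h (fun j => ?_) rfl
    simp [pow_add]
    ring
  · intro m hm
    rw [if_neg, zero_mul]
    exact fun h => hm ⟨m - r, Nat.sub_add_cancel h⟩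

theorem fiber_eq_image_trajSet (a b m : ℕ) :
    {g | g ∈ {g : List Bool | soScoreA g = a + 1 ∧ soScoreB g = b ∧ soLastA g} ∧
      g.count false / 2 = m} = (fun g => g ++ [true]) '' trajSet true a b (2 * m) := by
  ext g
  simp only [Set.mem_ofPred_eq, Set.mem_image, trajSet, soScoreA, soScoreB, soLastA]
  constructor
  · rintro ⟨⟨hA, hB, hg, hs⟩, hm⟩
    obtain ⟨h, rfl⟩ := List.getLast?_eq_some_iff.1 hg
    rw [soScorers_append_true] at hA hB hs
    rcases Nat.mod_two_eq_zero_or_one (h.count false) with hk | hk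
    · simp [hk] at hA hB hm
      exact ⟨h, ⟨hA, hB, by omega⟩, rfl⟩
    · simp [hk] at hs
  · rintro ⟨h, ⟨hA, hB, hk⟩, rfl⟩
    rw [soScorers_append_true]
    simp [hk, hA]
    simpa using hB

theorem hasSum_indicator_event (a b : ℕ) {pa pb : ℝ} (hpa0 : 0 ≤ pa) (hpa1 : pa ≤ 1)
    (hpb0 : 0 ≤ pb) (hpb1 : pb ≤ 1) (φ : ℕ → ℝ) (hφ : ∀ m, 0 ≤ φ m) {S : ℝ}
    (hS : HasSum (fun m : ℕ => ((m + 1).multichoose a * m.multichoose b : ℝ) *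
      (((1 - pa) * (1 - pb)) ^ m * φ (a + 1 + b + 2 * m))) S) :
    HasSum (Set.indicator {g : List Bool | soScoreA g = a + 1 ∧ soScoreB g = b ∧ soLastA g}
      (fun g => soWeight pa pb true g * φ g.length)) (pa ^ (a + 1) * pb ^ b * S) := by
  refine hasSum_indicator_of_encard_fiber _ (fun g => g.count false / 2)
    (fun m => (m + 1).multichoose a * m.multichoose b) _
    (fun m => pa ^ (a + 1) * pb ^ b *
      (((1 - pa) * (1 - pb)) ^ m * φ (a + 1 + b + 2 * m))) (fun m => ?_) (fun g hg => ?_)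
    (fun m => ?_) ?_
  · have := sub_nonneg.2 hpa1
    have := sub_nonneg.2 hpb1
    have := hφ (a + 1 + b + 2 * m)
    positivity
  · obtain ⟨h, hh, rfl⟩ := (fiber_eq_image_trajSet a b (g.count false / 2)).subset ⟨hg, rfl⟩
    obtain ⟨hA, hB, -⟩ := hg
    have hk : (h ++ [true]).count false = 2 * ((h ++ [true]).count false / 2) := by
      conv_lhs => rw [List.count_append, hh.2.2]
      simp
    rw [soScoreA] at hA
    rw [soScoreB] at hB
    have hl := length_eq true (h ++ [true])
    rw [hA, hB, hk] at hl
    rw [(soWeight_eq pa pb _).1, hA, hB, hl, mul_pow,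
      show ((h ++ [true]).count false + 1) / 2 = (h ++ [true]).count false / 2 by omega]
    ring
  · rw [fiber_eq_image_trajSet, (List.append_left_injective [true]).encard_image,
      encard_trajSet, show 2 * m / 2 = m by omega, show (2 * m + 1) / 2 = m by omega]
  · refine hasSum_real_of_eq (hS.mul_left (pa ^ (a + 1) * pb ^ b)) (fun m => ?_) rfl
    push_cast
    ring

theorem stmt_7 (α β : ℕ) (hα : 1 ≤ α) (pa pb : ℝ) (hpa0 : 0 < pa) (hpa1 : pa < 1)
    (hpb0 : 0 < pb) (hpb1 : pb < 1) :
    soCondExp pa pb {g : List Bool | soScoreA g = α ∧ soScoreB g = β ∧ soLastA g}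
        (fun g => (g.length : ℝ) ^ 2) -
      (soCondExp pa pb {g : List Bool | soScoreA g = α ∧ soScoreB g = β ∧ soLastA g}
        (fun g => (g.length : ℝ))) ^ 2 =
      4 * ((α : ℝ) + β) * ((1 - pa) * (1 - pb)) / (1 - (1 - pa) * (1 - pb)) ^ 2 +
        4 * ((∑ r ∈ Finset.Icc (min β 1) (min α β),
                (r : ℝ) ^ 2 * ((α.choose r : ℝ) * ((β - 1).choose (r - 1) : ℝ) *
                  ((1 - pa) * (1 - pb)) ^ r)) /
              (∑ r ∈ Finset.Icc (min β 1) (min α β),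
                (α.choose r : ℝ) * ((β - 1).choose (r - 1) : ℝ) * ((1 - pa) * (1 - pb)) ^ r) -
            ((∑ r ∈ Finset.Icc (min β 1) (min α β),
                (r : ℝ) * ((α.choose r : ℝ) * ((β - 1).choose (r - 1) : ℝ) *
                  ((1 - pa) * (1 - pb)) ^ r)) /
              (∑ r ∈ Finset.Icc (min β 1) (min α β),
                (α.choose r : ℝ) * ((β - 1).choose (r - 1) : ℝ) *
                  ((1 - pa) * (1 - pb)) ^ r)) ^ 2) := by
  obtain ⟨a, rfl⟩ := Nat.exists_eq_add_of_le' hα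
  set q := (1 - pa) * (1 - pb) with hq
  have hq0 : 0 < q := mul_pos (sub_pos.2 hpa1) (sub_pos.2 hpb1)
  have hq1 : q < 1 := by
    nlinarith
  have hqn : ‖q‖ < 1 := by rwa [Real.norm_of_nonneg hq0.le]
  set I := Finset.Icc (min β 1) (min (a + 1) β) with hI
  set W : ℕ → ℝ := fun r => ((a + 1).choose r : ℝ) * ((β - 1).choose (r - 1) : ℝ) * q ^ r
    with hW
  have hS0 : 0 < ∑ r ∈ I, W r := by
    refine Finset.sum_pos' (fun r _ => by positivity) ⟨min β 1, ?_, ?_⟩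
    · rw [hI, Finset.mem_Icc]
      omega
    · rcases Nat.eq_zero_or_pos β with rfl | hβ
      · simp [hW]
      · rw [min_eq_right hβ]
        simp only [hW, Nat.choose_one_right, Nat.sub_self, Nat.choose_zero_right, pow_one]
        positivity
  have hmoment := fun (φ : ℕ → ℝ) (hφ : ∀ m, 0 ≤ φ m) (u v w : ℝ)
      (h : ∀ m : ℕ, φ (a + 1 + β + 2 * m) = u + v * m + w * (m : ℝ) ^ 2) =>
    (hasSum_indicator_event a β hpa0.le hpa1.le hpb0.le hpb1.le φ hφ
      (hasSum_real_of_eq (hasSum_multichoose_mul_quadratic a β hqn u v w)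
        (fun m => by rw [h m]) rfl)).tsum_eq
  have h0 := hmoment (fun _ => 1) (fun _ => zero_le_one) 1 0 0 (fun m => by ring)
  have h1 := hmoment (fun l => l) (fun l => l.cast_nonneg) (a + 1 + β) 2 0
    (fun m => by push_cast; ring)
  have h2 := hmoment (fun l => (l : ℝ) ^ 2) (fun l => sq_nonneg _) ((a + 1 + β) ^ 2)
    (4 * (a + 1 + β)) 4 (fun m => by push_cast; ring)
  simp only [mul_one] at h0
  rw [soCondExp, soCondExp, soPr, h0, h1, h2]
  change _ = _ + 4 * ((∑ r ∈ I, (r : ℝ) ^ 2 * W r) / (∑ r ∈ I, W r) -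
    ((∑ r ∈ I, (r : ℝ) * W r) / (∑ r ∈ I, W r)) ^ 2)
  have hsum : ∀ u v w : ℝ, ∑ r ∈ I, ((a + 1).choose r * (β - 1).choose (r - 1) : ℝ) * q ^ r *
        (1 / (1 - q) ^ (a + β + 1) * ((u + v * r + w * (r : ℝ) ^ 2) +
          (v + 2 * w * r) * ((a + β + 1) * (q / (1 - q))) +
          w * ((a + β + 1) * (q / (1 - q)) + (a + β + 1) * (a + β + 2) * (q / (1 - q)) ^ 2))) =
      1 / (1 - q) ^ (a + β + 1) * ((u + v * ((a + β + 1) * (q / (1 - q))) +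
          w * ((a + β + 1) * (q / (1 - q)) + (a + β + 1) * (a + β + 2) * (q / (1 - q)) ^ 2)) *
          ∑ r ∈ I, W r +
        (v + 2 * w * ((a + β + 1) * (q / (1 - q)))) * (∑ r ∈ I, (r : ℝ) * W r) +
        w * ∑ r ∈ I, (r : ℝ) ^ 2 * W r) := by
    intro u v w
    simp only [Finset.mul_sum, ← Finset.sum_add_distrib]
    refine Finset.sum_congr rfl fun r _ => ?_
    simp only [hW]
    ring
  rw [hsum, hsum, hsum]
  have hq' : 1 - q ≠ 0 := (sub_pos.2 hq1).ne'
  have hpa := hpa0.ne'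
  have hpb := hpb0.ne'
  generalize ∑ r ∈ I, W r = S at *
  generalize ∑ r ∈ I, (r : ℝ) * W r = S₁
  generalize ∑ r ∈ I, (r : ℝ) ^ 2 * W r = S₂
  have hS := hS0.ne'
  clear_value q
  push_cast
  field_simp
  ring
end
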